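/- There is an absolute constant C such that for all sufficiently large n, with m = ⌊n − n^{3/4}·ln n⌋ and any natural number s with s < 2^m, one has | ∑_{k=0}^{2^{n−m}−1} N(k) − (#𝒫_n)² / 2^m | ≤ C · 2^{n−m} · #𝒫_n / n². -/

import Mathlib

/-- `𝒫 n` is the set of primes `p` with `2^(n-1) < p < 2^n`. -/
def primesP (n : ℕ) : Finset ℕ := (Finset.Ioo (2^(n-1)) (2^n)).filter Nat.Prime

/-- `countN n m s k` is the number of ordered pairs `(p, ℓ)` of primes `p, ℓ ∈ 𝒫 n`
with `p * ℓ ≡ 2^(n-m) * s + k (mod 2^n)`. -/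
def countN (n m : ℕ) (s : ℕ) (k : ℤ) : ℕ :=
  ((primesP n ×ˢ primesP n).filter
    (fun pq => ((pq.1 * pq.2 : ℤ)) ≡ 2 ^ (n - m) * s + k [ZMOD 2 ^ n])).card


open PowerSeries in
/-- Evaluate the product at shifted roots via the coefficients of the reversed polynomial. -/
theorem sv_prod_add_eq (k : ℕ) (y : Fin k → ℤ) (w : ℤ) :
    ∏ j, (w + y j) = ∑ i ∈ Finset.range (k+1), w ^ (k - i) *
      PowerSeries.coeff i (∏ j, (1 + C (y j) * X : PowerSeries ℤ)) := by
  have h1 : (∏ j, (1 + C (y j) * X : PowerSeries ℤ)) =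
      ∑ t ∈ (Finset.univ : Finset (Fin k)).powerset, C (∏ j ∈ t, y j) * X ^ t.card := by
    have h := Finset.prod_add (fun j : Fin k => (C (y j) * X : PowerSeries ℤ)) (fun _ => 1) Finset.univ
    simp only [Finset.prod_const_one, mul_one] at h
    rw [show (∏ j, (1 + C (y j) * X : PowerSeries ℤ)) = ∏ j, (C (y j) * X + 1 : PowerSeries ℤ) from
      Finset.prod_congr rfl (fun _ _ => add_comm _ _), h]
    refine Finset.sum_congr rfl fun t _ => ?_
    rw [Finset.prod_mul_distrib, Finset.prod_const, map_prod]
  have h2 : ∏ j, (w + y j) = ∑ t ∈ (Finset.univ : Finset (Fin k)).powerset,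
      w ^ (k - t.card) * ∏ j ∈ t, y j := by
    have h := Finset.prod_add (fun j : Fin k => y j) (fun _ => w) Finset.univ
    rw [show (∏ j, (w + y j)) = ∏ j, (y j + w) from
      Finset.prod_congr rfl (fun _ _ => add_comm _ _), h]
    refine Finset.sum_congr rfl fun t _ => ?_
    rw [Finset.prod_const, Finset.card_sdiff_of_subset (Finset.subset_univ t)]
    simp [mul_comm]
  rw [h1, h2]
  simp only [map_sum, PowerSeries.coeff_C_mul, PowerSeries.coeff_X_pow, Finset.mul_sum]
  rw [Finset.sum_comm]
  refine Finset.sum_congr rfl fun t _ => ?_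
  have : t.card ∈ Finset.range (k+1) := by
    have := Finset.card_le_univ t
    simp at this ⊢; omega
  rw [Finset.sum_eq_single_of_mem _ this]
  · simp
  · intro b _ hb; simp [hb]

open PowerSeries in
/-- Root rigidity. -/
theorem sv_roots {π d k : ℕ} (hπ : π.Prime) (y y' : Fin k → ℤ)
    (hd : ∀ i j, j ≠ i → ¬ (π : ℤ) ∣ y j - y' i)
    (h : ∀ i ≤ k, ((π ^ d : ℕ) : ℤ) ∣ coeff i (∏ j, (1 + C (y j) * X : PowerSeries ℤ)) -
      coeff i (∏ j, (1 + C (y' j) * X : PowerSeries ℤ))) (i : Fin k) :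
    ((π ^ d : ℕ) : ℤ) ∣ y i - y' i := by
  have e : ((π ^ d : ℕ) : ℤ) ∣ ∏ j, (-(y' i) + y j) - ∏ j, (-(y' i) + y' j) := by
    rw [sv_prod_add_eq, sv_prod_add_eq, ← Finset.sum_sub_distrib]
    refine Finset.dvd_sum fun l hl => ?_
    rw [← mul_sub]
    exact Dvd.dvd.mul_left (h l (by simp at hl; omega)) _
  have z : ∏ j, (-(y' i) + y' j) = 0 := Finset.prod_eq_zero (Finset.mem_univ i) (by ring)
  rw [z, sub_zero, ← Finset.mul_prod_erase _ _ (Finset.mem_univ i)] at e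
  have hpr : Prime (π : ℤ) := Nat.prime_iff_prime_int.mp hπ
  have hc : IsCoprime ((π ^ d : ℕ) : ℤ) (∏ j ∈ Finset.univ.erase i, (-(y' i) + y j)) := by
    push_cast
    refine IsCoprime.pow_left ?_
    refine IsCoprime.prod_right fun j hj => ?_
    refine (Prime.coprime_iff_not_dvd hpr).2 ?_
    have := hd i j (Finset.ne_of_mem_erase hj)
    rwa [show -(y' i) + y j = y j - y' i by ring]
  have := hc.dvd_of_dvd_mul_right e
  rwa [show -(y' i) + y i = y i - y' i by ring] at this

open PowerSeries in
theorem sv_unit_prod {ι : Type*} (s : Finset ι) (c : ι → ℤ) :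
    IsUnit (∏ j ∈ s, (1 + C (c j) * X : PowerSeries ℤ)) := by
  rw [PowerSeries.isUnit_iff_constantCoeff]
  simp [map_prod]

open PowerSeries in
theorem sv_const_prod {ι : Type*} (s : Finset ι) (c : ι → ℤ) :
    constantCoeff (∏ j ∈ s, (1 + C (c j) * X : PowerSeries ℤ)) = 1 := by
  simp [map_prod]

open PowerSeries in
theorem sv_unit_of_const {f : PowerSeries ℤ} (h : constantCoeff f = 1) : IsUnit f := by
  rw [PowerSeries.isUnit_iff_constantCoeff, h]; exact isUnit_one

open PowerSeries in
/-- The first block. -/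
theorem sv_block {π d k : ℕ} (hπ : π.Prime) (Y : Fin k → Finset ℤ) (c : ℕ)
    (hY : ∀ i j, j ≠ i → ∀ a ∈ Y j, ∀ b ∈ Y i, ¬ (π : ℤ) ∣ a - b)
    (hc : ∀ j, ∀ r : ℤ, ((Y j).filter (fun y => (((π ^ d)^k : ℕ) : ℤ) ∣ y - r)).card ≤ c)
    (Λ : PowerSeries ℤ) (S : Finset (Fin k → ℤ)) (hS : S ⊆ Fintype.piFinset Y)
    (h : ∀ y ∈ S, ∃ R : PowerSeries ℤ, constantCoeff R = 1 ∧
      (X : PowerSeries ℤ) ^ (k+1) ∣ (∏ j, (1 + C (y j) * X : PowerSeries ℤ)) * rescale ((π ^ d : ℕ) : ℤ) R - Λ) :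
    S.card ≤ c ^ k * (π ^ d) ^ (∑ i ∈ Finset.range k, i) := by
  classical
  rcases S.eq_empty_or_nonempty with rfl | ⟨y0, hy0⟩
  · simp
  set p : ℕ := π ^ d with hp
  have hp0 : p ≠ 0 := pow_ne_zero _ hπ.ne_zero
  -- choose W
  have hW : ∀ y ∈ S, ∃ W : PowerSeries ℤ, constantCoeff W = 1 ∧
      (X : PowerSeries ℤ) ^ (k+1) ∣ (∏ j, (1 + C (y j) * X : PowerSeries ℤ)) -
        (∏ j, (1 + C (y0 j) * X : PowerSeries ℤ)) * rescale (p : ℤ) W := by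
    intro y hy
    obtain ⟨R, hR, hdR⟩ := h y hy
    obtain ⟨R0, hR0, hdR0⟩ := h y0 hy0
    obtain ⟨V, hV⟩ := (sv_unit_of_const hR).exists_right_inv
    have hVc : constantCoeff V = 1 := by
      have := congrArg (constantCoeff (R := ℤ)) hV
      simpa [hR] using this
    refine ⟨R0 * V, by simp [hR0, hVc], ?_⟩
    have e1 : rescale (p : ℤ) R * rescale (p : ℤ) V = 1 := by
      rw [← map_mul, hV, map_one]
    have e2 := Dvd.dvd.mul_right (dvd_sub hdR hdR0) (rescale (p : ℤ) V)
    have e3 : (∏ j, (1 + C (y j) * X : PowerSeries ℤ)) -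
        (∏ j, (1 + C (y0 j) * X : PowerSeries ℤ)) * rescale (p : ℤ) (R0 * V) =
      ((∏ j, (1 + C (y j) * X : PowerSeries ℤ)) * rescale (p : ℤ) R - Λ -
        ((∏ j, (1 + C (y0 j) * X : PowerSeries ℤ)) * rescale (p : ℤ) R0 - Λ)) * rescale (p : ℤ) V := by
      rw [map_mul]
      linear_combination (-(∏ j, (1 + C (y j) * X : PowerSeries ℤ))) * e1
    rw [e3]; exact e2
  choose! W hW1 hW2 using hW
  have : ∀ i : Fin k, NeZero (p ^ (k - 1 - (i : ℕ))) := fun i => ⟨pow_ne_zero _ hp0⟩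
  let f : (Fin k → ℤ) → (∀ i : Fin k, ZMod (p ^ (k - 1 - (i:ℕ)))) := fun y i =>
    ((coeff ((i : ℕ)+1) (W y) : ℤ) : ZMod (p ^ (k - 1 - (i:ℕ))))
  have hfib : ∀ b ∈ S.image f, (S.filter (fun y => f y = b)).card ≤ c ^ k := by
    intro b hb
    obtain ⟨y1, hy1, rfl⟩ := Finset.mem_image.1 hb
    have hsub : S.filter (fun y => f y = f y1) ⊆
        Fintype.piFinset (fun j => (Y j).filter (fun y => ((p ^ k : ℕ) : ℤ) ∣ y - y1 j)) := by
      intro y hy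
      obtain ⟨hyS, hyf⟩ := Finset.mem_filter.1 hy
      rw [Fintype.mem_piFinset]
      intro j
      have hyY := Fintype.mem_piFinset.1 (hS hyS)
      have hyY1 := Fintype.mem_piFinset.1 (hS hy1)
      refine Finset.mem_filter.2 ⟨hyY j, ?_⟩
      have hpk : p ^ k = π ^ (d * k) := by rw [hp, ← pow_mul]
      rw [hpk]
      refine sv_roots hπ y y1 (fun i j hij => hY i j hij _ (hyY j) _ (hyY1 i)) ?_ j
      rw [← hpk]
      -- coefficient congruence
      have hco : ∀ i ≤ k, ((p ^ k : ℕ) : ℤ) ∣ coeff i (rescale (p : ℤ) (W y)) - coeff i (rescale (p:ℤ) (W y1)) := by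
        intro i hi
        rw [coeff_rescale, coeff_rescale, ← mul_sub]
        rcases Nat.eq_zero_or_pos i with rfl | hi0
        · have a1 := hW1 y hyS
          have a2 := hW1 y1 hy1
          rw [← PowerSeries.coeff_zero_eq_constantCoeff_apply] at a1 a2
          simp [a1, a2]
        · have := congrFun hyf ⟨i-1, by omega⟩
          simp only [f] at this
          rw [eq_comm, ZMod.intCast_eq_intCast_iff_dvd_sub] at this
          rw [show i - 1 + 1 = i by omega, show k - 1 - (i - 1) = k - i by omega] at this
          have e : ((p ^ k : ℕ) : ℤ) = (p : ℤ) ^ i * ((p ^ (k - i) : ℕ) : ℤ) := by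
            push_cast; rw [← pow_add]; congr 1; omega
          rw [e]
          exact mul_dvd_mul_left _ this
      intro i hi
      have a1 := PowerSeries.X_pow_dvd_iff.1 (hW2 y hyS) i (by omega)
      have a2 := PowerSeries.X_pow_dvd_iff.1 (hW2 y1 hy1) i (by omega)
      rw [map_sub, sub_eq_zero] at a1 a2
      rw [a1, a2, ← map_sub, ← mul_sub, PowerSeries.coeff_mul]
      refine Finset.dvd_sum fun q hq => ?_
      rw [map_sub]
      refine Dvd.dvd.mul_left (hco q.2 ?_) _
      have := Finset.HasAntidiagonal.mem_antidiagonal.1 hq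
      omega
    refine (Finset.card_le_card hsub).trans ?_
    rw [Fintype.card_piFinset]
    refine (Finset.prod_le_pow_card _ _ c fun j _ => hc j _).trans ?_
    simp
  refine (Finset.card_le_mul_card_image S (c ^ k) hfib).trans ?_
  refine Nat.mul_le_mul_left _ ?_
  refine (Finset.card_le_univ _).trans ?_
  rw [Fintype.card_pi]
  simp only [ZMod.card]
  rw [Finset.prod_pow_eq_pow_sum, Fin.sum_univ_eq_sum_range (fun i => k - 1 - i), Finset.sum_range_reflect (fun i => i)]

open PowerSeries in
/-- The multiplicity bound. -/
theorem sv_mult {π d k : ℕ} (hπ : π.Prime) (L : ℕ) : ∀ (Y : Fin L → Fin k → Finset ℤ) (c : Fin L → ℕ)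
    (_ : ∀ l i j, j ≠ i → ∀ a ∈ Y l j, ∀ b ∈ Y l i, ¬ (π : ℤ) ∣ a - b)
    (_ : ∀ l j, ∀ r : ℤ, ((Y l j).filter (fun y => (((π ^ d)^k : ℕ) : ℤ) ∣ y - r)).card ≤ c l)
    (Λ : PowerSeries ℤ) (S : Finset (Fin L → Fin k → ℤ))
    (_ : S ⊆ Fintype.piFinset (fun l => Fintype.piFinset (Y l)))
    (_ : ∀ y ∈ S, (X : PowerSeries ℤ) ^ (k+1) ∣
      (∏ l : Fin L, ∏ j, (1 + C (((π ^ d : ℕ) : ℤ) ^ (l : ℕ) * y l j) * X : PowerSeries ℤ)) - Λ),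
    S.card ≤ ∏ l, (c l ^ k * (π ^ d) ^ (∑ i ∈ Finset.range k, i)) := by
  classical
  induction L with
  | zero =>
    intro Y c _ _ Λ S _ _
    simp only [Finset.univ_eq_empty, Finset.prod_empty]
    exact (Finset.card_le_univ S).trans (by simp)
  | succ L ih =>
    intro Y c hY hc Λ S hS h
    have hp0 : ((π ^ d : ℕ) : ℤ) ≠ 0 := by exact_mod_cast pow_ne_zero _ hπ.ne_zero
    rw [Fin.prod_univ_succ]
    have hsplit : ∀ y : Fin (L+1) → Fin k → ℤ,
        (∏ l : Fin (L+1), ∏ j, (1 + C (((π ^ d : ℕ) : ℤ) ^ (l : ℕ) * y l j) * X : PowerSeries ℤ)) =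
        (∏ j, (1 + C (y 0 j) * X : PowerSeries ℤ)) * rescale ((π ^ d : ℕ) : ℤ)
          (∏ l : Fin L, ∏ j, (1 + C (((π ^ d : ℕ) : ℤ) ^ (l : ℕ) * y l.succ j) * X : PowerSeries ℤ)) := by
      intro y
      rw [Fin.prod_univ_succ]
      congr 1
      · simp
      · rw [map_prod]
        refine Finset.prod_congr rfl fun l _ => ?_
        rw [map_prod]
        refine Finset.prod_congr rfl fun j _ => ?_
        rw [map_add, map_one, (rescale ((π ^ d : ℕ) : ℤ)).map_mul, rescale_X]
        have : rescale ((π ^ d : ℕ) : ℤ) (C (((π ^ d : ℕ) : ℤ) ^ (l : ℕ) * y l.succ j)) =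
          C (((π ^ d : ℕ) : ℤ) ^ (l : ℕ) * y l.succ j) := by
          ext n; rw [coeff_rescale, coeff_C]; split_ifs with hn <;> simp [hn]
        rw [this, ← mul_assoc, ← (C (R := ℤ)).map_mul]
        congr 3
        simp [pow_succ]; ring
    have hconst : ∀ y : Fin (L+1) → Fin k → ℤ, constantCoeff
          (∏ l : Fin L, ∏ j, (1 + C (((π ^ d : ℕ) : ℤ) ^ (l : ℕ) * y l.succ j) * X : PowerSeries ℤ)) = 1 := by
      intro y; simp [map_prod]
    have hfib : ∀ b ∈ S.image (fun y => y 0), (S.filter (fun y => y 0 = b)).card ≤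
        ∏ l : Fin L, (c l.succ ^ k * (π ^ d) ^ (∑ i ∈ Finset.range k, i)) := by
      intro b hb
      obtain ⟨y1, hy1, rfl⟩ := Finset.mem_image.1 hb
      have hinj : Set.InjOn (fun y : Fin (L+1) → Fin k → ℤ => fun l : Fin L => y l.succ)
          (S.filter (fun y => y 0 = y1 0) : Finset _) := by
        intro y hy y' hy' he
        have h1 := (Finset.mem_filter.1 (Finset.mem_coe.1 hy)).2
        have h2 := (Finset.mem_filter.1 (Finset.mem_coe.1 hy')).2
        funext l
        refine Fin.cases ?_ (fun l => ?_) l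
        · rw [h1, h2]
        · exact congrFun he l
      rw [← Finset.card_image_of_injOn hinj]
      refine ih (fun l => Y l.succ) (fun l => c l.succ) (fun l => hY l.succ) (fun l => hc l.succ)
        (∏ l : Fin L, ∏ j, (1 + C (((π ^ d : ℕ) : ℤ) ^ (l : ℕ) * y1 l.succ j) * X : PowerSeries ℤ)) _ ?_ ?_
      · intro z hz
        obtain ⟨y, hy, rfl⟩ := Finset.mem_image.1 hz
        have := Fintype.mem_piFinset.1 (hS (Finset.mem_filter.1 hy).1)
        exact Fintype.mem_piFinset.2 fun l => this l.succ
      · intro z hz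
        obtain ⟨y, hy, rfl⟩ := Finset.mem_image.1 hz
        obtain ⟨hyS, hy0⟩ := Finset.mem_filter.1 hy
        have a1 := h y hyS
        have a2 := h y1 hy1
        rw [hsplit] at a1 a2
        rw [hy0] at a1
        have a3 := dvd_sub a1 a2
        rw [sub_sub_sub_cancel_right, ← mul_sub, IsUnit.dvd_mul_left (sv_unit_prod _ _), ← map_sub] at a3
        rw [PowerSeries.X_pow_dvd_iff] at a3 ⊢
        intro m hm
        have := a3 m hm
        rw [coeff_rescale] at this
        exact (mul_eq_zero.1 this).resolve_left (pow_ne_zero _ hp0)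
    refine (Finset.card_le_mul_card_image S _ hfib).trans ?_
    rw [mul_comm]
    refine Nat.mul_le_mul_right _ ?_
    refine sv_block hπ (Y 0) (c 0) (hY 0) (hc 0) Λ _ ?_ ?_
    · intro z hz
      obtain ⟨y, hy, rfl⟩ := Finset.mem_image.1 hz
      exact Fintype.mem_piFinset.1 (hS hy) 0
    · intro z hz
      obtain ⟨y, hy, rfl⟩ := Finset.mem_image.1 hz
      exact ⟨_, hconst y, by rw [← hsplit]; exact h y hy⟩

/-- Multiplicative function on the integers, of exact level `2 ^ N`. -/
structure SvChar (N : ℕ) (χ : ℤ → ℂ) : Prop where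
  mul : ∀ x y, χ (x * y) = χ x * χ y
  per : ∀ x y, (2 ^ N : ℤ) ∣ x - y → χ x = χ y
  norm_odd : ∀ x, Odd x → ‖χ x‖ = 1
  even_zero : ∀ x, Even x → χ x = 0
  one : χ 1 = 1
  neg : χ (1 + 2 ^ (N - 1)) = -1

theorem sv_shift_sum (g : ℤ → ℂ) (P : ℕ) (hg : ∀ x, g (x + P) = g x) (c : ℤ) (e : ℕ) :
    ∑ i ∈ Finset.range P, g (c + e + i) = ∑ i ∈ Finset.range P, g (c + i) := by
  induction e with
  | zero => simp
  | succ e ih =>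
    rw [← ih]
    have h1 := Finset.sum_range_succ (fun i : ℕ => g (c + e + i)) P
    have h2 := Finset.sum_range_succ' (fun i : ℕ => g (c + e + i)) P
    rw [h1] at h2
    rw [hg] at h2
    simp only [Nat.cast_zero, add_zero] at h2
    rw [add_right_cancel h2]
    refine Finset.sum_congr rfl fun i _ => ?_
    congr 1; push_cast; ring

theorem sv_sum_Ico (f : ℤ → ℂ) (c : ℤ) (P : ℕ) :
    ∑ ν ∈ Finset.Ico c (c + P), f ν = ∑ i ∈ Finset.range P, f (c + i) := by
  rw [show Finset.Ico c (c + P) = (Finset.range ((c + P) - c).toNat).map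
    (Nat.castEmbedding.trans (addLeftEmbedding c)) from rfl, Finset.sum_map]
  simp

theorem sv_odd_pow_sub {k : ℕ} (hk : Odd k) {a b : ℤ} (ha : Odd a) (hb : Odd b) {u : ℕ}
    (h : (2 ^ u : ℤ) ∣ a ^ k - b ^ k) : (2 ^ u : ℤ) ∣ a - b := by
  rw [← Commute.mul_geom_sum₂ (Commute.all a b)] at h
  have hodd : Odd (∑ i ∈ Finset.range k, a ^ i * b ^ (k - 1 - i)) := by
    have h1 : (2:ℤ) ∣ ∑ i ∈ Finset.range k, (a ^ i * b ^ (k - 1 - i) - 1) := by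
      refine Finset.dvd_sum fun i _ => ?_
      have := (ha.pow (n := i)).mul (hb.pow (n := k - 1 - i))
      exact (this.sub_odd odd_one).two_dvd
    rw [Finset.sum_sub_distrib] at h1
    simp only [Finset.sum_const, Finset.card_range, nsmul_eq_mul, mul_one] at h1
    have h2 : Odd (k : ℤ) := by exact_mod_cast hk
    have h3 := (even_iff_two_dvd.2 h1).add_odd h2
    simpa using h3
  refine IsCoprime.dvd_of_dvd_mul_right ?_ h
  refine IsCoprime.pow_left ?_
  rw [Int.isCoprime_iff_gcd_eq_one, Int.gcd_comm]
  exact (Int.isCoprime_iff_gcd_eq_one.1 (by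
    obtain ⟨m, hm⟩ := hodd
    exact ⟨1, -m, by rw [hm]; ring⟩))

theorem sv_sieve {N : ℕ} {χ : ℤ → ℂ} (hχ : SvChar N χ) {t k u : ℕ} (hN : N = t * k + u)
    (hu : 1 ≤ u) (hut : u ≤ t) (hk : Odd k) (A : Finset ℕ) (ζ : ℕ → ℤ) (θ : ℕ → ℂ) (Q : ℕ → ℤ)
    (hθ : ∀ α ∈ A, ‖θ α‖ ≤ 1) (hQ : ∀ α ∈ A, (2 ^ t : ℤ) ∣ Q α - 1) (hζ : ∀ α ∈ A, Odd (ζ α))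
    (hinj : ∀ α ∈ A, ∀ α' ∈ A, α ≠ α' → ¬ (2 ^ u : ℤ) ∣ ζ α - ζ α') (c : ℤ) :
    ∑ ν ∈ Finset.Ico c (c + (2 ^ u : ℕ)), ‖∑ α ∈ A, θ α * χ (Q α + ν * (2 ^ t * ζ α) ^ k)‖ ^ 2 ≤
      2 ^ u * (A.card : ℝ) := by
  have hk1 : 1 ≤ k := hk.pos
  have htk : t ≤ t * k := Nat.le_mul_of_pos_right t hk1
  set ψ : ℤ → ℂ := fun y => χ (1 + 2 ^ (t * k) * y) with hψ
  have hoddψ : ∀ y : ℤ, Odd (1 + 2 ^ (t * k) * y) := by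
    intro y
    refine Odd.add_even odd_one (Even.mul_right ?_ _)
    exact (even_two).pow_of_ne_zero (by omega)
  have ψadd : ∀ x y, ψ (x + y) = ψ x * ψ y := by
    intro x y
    simp only [hψ]
    rw [← hχ.mul]
    apply hχ.per
    refine Dvd.dvd.trans (pow_dvd_pow 2 (show N ≤ t*k + t*k by omega)) ?_
    exact ⟨-(x*y), by rw [pow_add]; ring⟩
  have ψnorm : ∀ x, ‖ψ x‖ = 1 := fun x => hχ.norm_odd _ (hoddψ x)
  have ψper : ∀ x y, (2 ^ u : ℤ) ∣ x - y → ψ x = ψ y := by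
    intro x y ⟨m, hm⟩
    apply hχ.per
    refine ⟨m, ?_⟩
    rw [hN, pow_add]; linear_combination (2:ℤ)^(t*k) * hm
  have ψneg : ∀ o : ℤ, Odd o → ψ (2 ^ (u-1) * o) = -1 := by
    intro o ⟨m, hm⟩
    rw [← hχ.neg]
    apply hχ.per
    refine ⟨m, ?_⟩
    have e1 : (2:ℤ) ^ N = 2 ^ (t*k) * 2 ^ (u-1) * 2 := by
      rw [← pow_add, ← pow_succ]; congr 1; omega
    have e2 : (2:ℤ) ^ (N-1) = 2 ^ (t*k) * 2 ^ (u-1) := by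
      rw [← pow_add]; congr 1; omega
    rw [e1, e2, hm]; ring
  -- rewriting each term
  have hterm : ∀ α ∈ A, ∀ ν : ℤ, χ (Q α + ν * (2 ^ t * ζ α) ^ k) = χ (Q α) * ψ (ν * ζ α ^ k) := by
    intro α hα ν
    simp only [hψ]
    rw [← hχ.mul]
    apply hχ.per
    obtain ⟨m, hm⟩ := hQ α hα
    refine Dvd.dvd.trans (pow_dvd_pow 2 (show N ≤ t*k + t by omega)) ?_
    refine ⟨-(m * ν * ζ α ^ k), ?_⟩
    have e : (2 ^ t * ζ α) ^ k = 2 ^ (t*k) * ζ α ^ k := by rw [mul_pow, ← pow_mul]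
    rw [e, pow_add]
    have : Q α = 1 + 2 ^ t * m := by linear_combination hm
    rw [this]; ring
  have horth : ∀ α ∈ A, ∀ α' ∈ A, α ≠ α' →
      ∑ ν ∈ Finset.Ico c (c + (2 ^ u : ℕ)), ψ (ν * ζ α ^ k) * (starRingEnd ℂ) (ψ (ν * ζ α' ^ k)) = 0 := by
    intro α hα α' hα' hne
    have hnd : ¬ (2 ^ u : ℤ) ∣ ζ α ^ k - ζ α' ^ k := fun hd =>
      hinj α hα α' hα' hne (sv_odd_pow_sub hk (hζ α hα) (hζ α' hα') hd)
    set D := ζ α ^ k - ζ α' ^ k with hD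
    have hD0 : D ≠ 0 := by rintro h0; exact hnd (h0 ▸ dvd_zero _)
    have hg : ∀ ν : ℤ, ψ (ν * ζ α ^ k) * (starRingEnd ℂ) (ψ (ν * ζ α' ^ k)) = ψ (ν * D) := by
      intro ν
      have e : ψ (ν * ζ α ^ k) = ψ (ν * D) * ψ (ν * ζ α' ^ k) := by
        rw [← ψadd]; congr 1; rw [hD]; ring
      rw [e, mul_assoc, Complex.mul_conj', ψnorm]; simp
    simp only [hg]
    obtain ⟨v, o, ho, hDo⟩ : ∃ v : ℕ, ∃ o : ℤ, Odd o ∧ D = 2 ^ v * o := by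
      obtain ⟨v, o, ho, h⟩ := (FiniteMultiplicity.exists_eq_pow_mul_and_not_dvd
        (Int.finiteMultiplicity_iff.2 ⟨by decide, hD0⟩) : ∃ c, D = 2 ^ (multiplicity 2 D) * c ∧ ¬ 2 ∣ c) |>.elim
        (fun c hc => (⟨_, c, hc.1, hc.2⟩ : ∃ v : ℕ, ∃ c : ℤ, D = 2 ^ v * c ∧ ¬ 2 ∣ c))
      exact ⟨v, o, by rwa [← Int.not_even_iff_odd, even_iff_two_dvd], ho⟩
    have hv : v < u := by
      by_contra hv
      push Not at hv
      exact hnd (hDo ▸ (Dvd.dvd.mul_right (pow_dvd_pow 2 hv) o))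
    rw [sv_sum_Ico (fun ν => ψ (ν * D))]
    have hs := sv_shift_sum (fun ν => ψ (ν * D)) (2 ^ u) (by
      intro x; apply ψper; exact ⟨D, by push_cast; ring⟩) c (2 ^ (u - 1 - v))
    have hneg : ∀ i : ℕ, ψ ((c + (2 ^ (u-1-v) : ℕ) + i) * D) = - ψ ((c + i) * D) := by
      intro i
      have e : (c + (2 ^ (u-1-v) : ℕ) + i) * D = (c + i) * D + 2 ^ (u-1) * o := by
        have : (2:ℤ) ^ (u-1) = 2 ^ (u-1-v) * 2 ^ v := by rw [← pow_add]; congr 1; omega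
        rw [this, hDo]; push_cast; ring
      rw [e, ψadd, ψneg o ho]; ring
    simp only [hneg, Finset.sum_neg_distrib] at hs
    have h2 := eq_neg_iff_add_eq_zero.1 hs.symm
    rw [← two_mul] at h2
    exact (mul_eq_zero.1 h2).resolve_left two_ne_zero
  have key : ((∑ ν ∈ Finset.Ico c (c + (2 ^ u : ℕ)), ‖∑ α ∈ A, θ α * χ (Q α + ν * (2 ^ t * ζ α) ^ k)‖ ^ 2 : ℝ) : ℂ) =
      ((∑ α ∈ A, ‖θ α * χ (Q α)‖ ^ 2 * 2 ^ u : ℝ) : ℂ) := by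
    push_cast
    have e1 : ∀ ν ∈ Finset.Ico c (c + (2 ^ u : ℕ)),
        ((‖∑ α ∈ A, θ α * χ (Q α + ν * (2 ^ t * ζ α) ^ k)‖ : ℂ)) ^ 2 =
        ∑ α ∈ A, ∑ α' ∈ A, (θ α * χ (Q α)) * (starRingEnd ℂ) (θ α' * χ (Q α')) *
          (ψ (ν * ζ α ^ k) * (starRingEnd ℂ) (ψ (ν * ζ α' ^ k))) := by
      intro ν _
      rw [← Complex.mul_conj', map_sum, Finset.sum_mul_sum]
      refine Finset.sum_congr rfl fun α hα => Finset.sum_congr rfl fun α' hα' => ?_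
      rw [hterm α hα, hterm α' hα']
      simp only [map_mul]; ring
    rw [show (Finset.Ico c (c + 2 ^ u)) = Finset.Ico c (c + (2 ^ u : ℕ)) by push_cast; rfl]
    rw [Finset.sum_congr rfl e1, Finset.sum_comm]
    refine Finset.sum_congr rfl fun α hα => ?_
    rw [Finset.sum_comm, Finset.sum_eq_single_of_mem α hα]
    · rw [← Finset.mul_sum, Complex.mul_conj']
      rw [Finset.sum_congr rfl (fun ν _ => by rw [Complex.mul_conj', ψnorm])]
      rw [Finset.sum_const, Int.card_Ico, add_sub_cancel_left, Int.toNat_natCast]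
      simp
    · intro α' hα' hne
      rw [← Finset.mul_sum, horth α hα α' hα' (Ne.symm hne), mul_zero]
  have key' := Complex.ofReal_injective key
  rw [key']
  calc ∑ α ∈ A, ‖θ α * χ (Q α)‖ ^ 2 * (2:ℝ) ^ u ≤ ∑ α ∈ A, (2:ℝ) ^ u := by
        refine Finset.sum_le_sum fun α hα => ?_
        have h1 : ‖χ (Q α)‖ = 1 := by
          apply hχ.norm_odd
          obtain ⟨m, hm⟩ := hQ α hα
          have : Q α = 2 ^ t * m + 1 := by linear_combination hm
          rw [this]
          exact (Even.mul_right (even_two.pow_of_ne_zero (by omega)) _).add_one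
        rw [norm_mul, h1, mul_one]
        have := pow_le_one₀ (n := 2) (norm_nonneg (θ α)) (hθ α hα)
        have h2 : (0:ℝ) < 2 ^ u := by positivity
        nlinarith
    _ = 2 ^ u * (A.card : ℝ) := by simp [mul_comm]

theorem sv_sum_range_mul (g : ℕ → ℂ) (p M : ℕ) :
    ∑ y ∈ Finset.range (p * M), g y = ∑ v ∈ Finset.range p, ∑ y ∈ Finset.range M, g (v + p * y) := by
  induction M with
  | zero => simp
  | succ M ih =>
    rw [Nat.mul_succ, Finset.sum_range_add, ih, ← Finset.sum_add_distrib]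
    refine Finset.sum_congr rfl fun v _ => ?_
    rw [Finset.sum_range_succ, add_comm (p * M) v]

theorem sv_c1 (g : ℕ → ℂ) (p M : ℕ) (η : ℝ) (hp : 0 < p)
    (h : η * (p * M : ℕ) ≤ ‖∑ y ∈ Finset.range (p * M), g y‖) :
    ∃ v < p, η * M ≤ ‖∑ y ∈ Finset.range M, g (v + p * y)‖ := by
  by_contra hc
  push Not at hc
  rw [sv_sum_range_mul] at h
  have h1 : ‖∑ v ∈ Finset.range p, ∑ y ∈ Finset.range M, g (v + p * y)‖ < ∑ v ∈ Finset.range p, η * M :=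
    (norm_sum_le _ _).trans_lt (Finset.sum_lt_sum_of_nonempty ⟨0, by simpa using hp⟩
      (fun v hv => hc v (by simpa using hv)))
  rw [Finset.sum_const, Finset.card_range, nsmul_eq_mul] at h1
  push_cast at h
  nlinarith

theorem sv_c2 (g : ℕ → ℂ) (hg : ∀ y, ‖g y‖ ≤ 1) (π M k : ℕ) (η : ℝ) (hM : 0 < M)
    (hk : (k : ℝ) ≤ η / 2 * π)
    (h : η * (π * M : ℕ) ≤ ‖∑ y ∈ Finset.range (π * M), g y‖) :
    ∃ c : Fin k → Fin π, Function.Injective c ∧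
      ∀ j, η / 2 * M ≤ ‖∑ y ∈ Finset.range M, g ((c j : ℕ) + π * y)‖ := by
  classical
  let G : Finset (Fin π) := Finset.univ.filter
    (fun v => η / 2 * M ≤ ‖∑ y ∈ Finset.range M, g ((v : ℕ) + π * y)‖)
  rcases Nat.eq_zero_or_pos k with rfl | hkpos
  · exact ⟨fun j => j.elim0, fun j => j.elim0, fun j => j.elim0⟩
  have hη : 0 < η / 2 := by
    have h0 : (0:ℝ) < k := by exact_mod_cast hkpos
    have h1 : (0:ℝ) ≤ π := Nat.cast_nonneg _
    by_contra hh
    push Not at hh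
    nlinarith
  have hcard : k ≤ G.card := by
    by_contra hlt
    push Not at hlt
    rw [sv_sum_range_mul, ← Fin.sum_univ_eq_sum_range (fun v => ∑ y ∈ Finset.range M, g (v + π * y))] at h
    have h1 : ‖∑ v : Fin π, ∑ y ∈ Finset.range M, g ((v:ℕ) + π * y)‖ ≤
        ∑ v : Fin π, ((if v ∈ G then (M:ℝ) else 0) + η / 2 * M) := by
      refine (norm_sum_le _ _).trans (Finset.sum_le_sum fun v _ => ?_)
      by_cases hv : v ∈ G
      · simp only [hv, if_true]
        have : ‖∑ y ∈ Finset.range M, g ((v:ℕ) + π * y)‖ ≤ ∑ y ∈ Finset.range M, (1:ℝ) :=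
          (norm_sum_le _ _).trans (Finset.sum_le_sum fun y _ => hg _)
        simp at this
        have h2 : 0 ≤ η / 2 * M := by positivity
        linarith
      · simp only [hv, if_false, zero_add]
        simp only [G, Finset.mem_filter, Finset.mem_univ, true_and, not_le] at hv
        exact hv.le
    rw [Finset.sum_add_distrib, ← Finset.sum_filter, Finset.sum_const, Finset.sum_const] at h1
    simp only [Finset.filter_mem_eq_inter, Finset.univ_inter, Finset.card_univ, Fintype.card_fin,
      nsmul_eq_mul] at h1
    have h3 : (G.card : ℝ) < k := by exact_mod_cast hlt
    have hM' : (0:ℝ) < M := by exact_mod_cast hM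
    push_cast at h
    have h4 : (G.card : ℝ) * M < η / 2 * π * M := mul_lt_mul_of_pos_right (h3.trans_le hk) hM'
    nlinarith
  obtain ⟨e⟩ : Nonempty (Fin k ↪ G) :=
    Function.Embedding.nonempty_of_card_le (by simpa using hcard)
  refine ⟨fun j => (e j : Fin π), fun a b hab => e.injective (Subtype.ext hab), fun j => ?_⟩
  exact (Finset.mem_filter.1 (e j).2).2

theorem sv_chain (f : ℕ → ℂ) (hf : ∀ y, ‖f y‖ ≤ 1) (π d L k : ℕ) (η : ℝ) (hπ : 0 < π) (hd : 0 < d)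
    (hk0 : 0 < k) (hk : (k : ℝ) ≤ η / 2 * π)
    (h : η * ((π ^ d) ^ (L + k) : ℕ) ≤ ‖∑ y ∈ Finset.range ((π ^ d) ^ (L + k)), f y‖) :
    ∃ β : Fin ((π ^ d) ^ L), ∃ c : Fin L → Fin k → Fin π, (∀ l, Function.Injective (c l)) ∧
      ∀ (l : Fin L) (j : Fin k), η / 2 * ((π ^ (d * (L + k - l) - 1) : ℕ) : ℝ) ≤
        ‖∑ y ∈ Finset.range (π ^ (d * (L + k - l) - 1)),
          f ((β : ℕ) % (π ^ d) ^ (l : ℕ) + (π ^ d) ^ (l : ℕ) * ((c l j : ℕ) + π * y))‖ := by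
  set p := π ^ d with hp
  have hp0 : 0 < p := pow_pos hπ d
  have step : ∀ m ≤ L, ∃ β < p ^ m, ∀ l ≤ m, η * (p ^ (L + k - l) : ℕ) ≤
      ‖∑ y ∈ Finset.range (p ^ (L + k - l)), f (β % p ^ l + p ^ l * y)‖ := by
    intro m
    induction m with
    | zero =>
      intro _
      refine ⟨0, by simp, ?_⟩
      intro l hl
      obtain rfl : l = 0 := by omega
      simpa using h
    | succ m ih =>
      intro hm
      obtain ⟨β, hβ, hβ'⟩ := ih (by omega)
      have h1 := hβ' m le_rfl
      have e : p ^ (L + k - m) = p * p ^ (L + k - (m+1)) := by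
        rw [← pow_succ']; congr 1; omega
      rw [e] at h1
      obtain ⟨v, hv, hv'⟩ := sv_c1 _ _ _ _ hp0 h1
      have hmod : ∀ l ≤ m, (β + p ^ m * v) % p ^ l = β % p ^ l := by
        intro l hl
        have : p ^ m * v = p ^ l * (p ^ (m - l) * v) := by
          rw [← mul_assoc, ← pow_add]; congr 2; omega
        rw [this, Nat.add_mul_mod_self_left]
      have hlt : β + p ^ m * v < p ^ (m+1) := by
        rw [pow_succ]
        calc β + p ^ m * v < p ^ m + p ^ m * v := by omega
          _ = p ^ m * (v + 1) := by ring
          _ ≤ p ^ m * p := Nat.mul_le_mul_left _ hv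
      refine ⟨β + p ^ m * v, hlt, ?_⟩
      intro l hl
      rcases Nat.lt_or_ge l (m+1) with hl' | hl'
      · rw [hmod l (by omega)]
        exact hβ' l (by omega)
      · obtain rfl : l = m + 1 := by omega
        rw [Nat.mod_eq_of_lt hlt]
        rw [Nat.mod_eq_of_lt hβ] at hv'
        have e2 : ∀ y, β + p ^ m * v + p ^ (m + 1) * y = β + p ^ m * (v + p * y) := fun y => by ring
        simp only [e2]
        exact hv'
  obtain ⟨β, hβ, hβ'⟩ := step L le_rfl
  have hcell : ∀ l : Fin L, ∃ c : Fin k → Fin π, Function.Injective c ∧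
      ∀ j, η / 2 * ((π ^ (d * (L + k - l) - 1) : ℕ) : ℝ) ≤ ‖∑ y ∈ Finset.range (π ^ (d * (L + k - l) - 1)),
          f (β % p ^ (l : ℕ) + p ^ (l : ℕ) * ((c j : ℕ) + π * y))‖ := by
    intro l
    have h1 := hβ' l l.2.le
    have hpos : 1 ≤ d * (L + k - l) := Nat.mul_pos hd (by have := l.2; omega)
    have e : p ^ (L + k - l) = π * π ^ (d * (L + k - l) - 1) := by
      rw [hp, ← pow_mul, ← pow_succ']; congr 1; omega
    rw [e] at h1
    exact sv_c2 (fun y => f (β % p ^ (l : ℕ) + p ^ (l : ℕ) * y)) (fun y => hf _) π _ k η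
      (pow_pos hπ _) hk h1
  choose c hc1 hc2 using hcell
  exact ⟨⟨β, hβ⟩, c, hc1, hc2⟩

theorem sv_coeff_step (a : ℤ) (F : PowerSeries ℤ) (i : ℕ) :
    PowerSeries.coeff (i + 1) ((1 + PowerSeries.C a * PowerSeries.X) * F) =
      PowerSeries.coeff (i + 1) F + a * PowerSeries.coeff i F := by
  rw [add_mul, one_mul, map_add, mul_assoc, PowerSeries.coeff_C_mul, PowerSeries.coeff_succ_X_mul]

theorem sv_coeff_zero (a : ℤ) (F : PowerSeries ℤ) :
    PowerSeries.coeff 0 ((1 + PowerSeries.C a * PowerSeries.X) * F) =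
      PowerSeries.coeff 0 F := by
  simp

theorem sv_coeff_zero_prod {ι : Type*} (S : Finset ι) (a : ι → ℤ) :
    PowerSeries.coeff 0 (∏ i ∈ S, (1 + PowerSeries.C (a i) * PowerSeries.X)) = (1 : ℤ) := by
  classical
  induction S using Finset.induction_on with
  | empty => simp
  | insert b S hb ih => rw [Finset.prod_insert hb, sv_coeff_zero, ih]

theorem sv_coeff_bound {ι : Type*} (S : Finset ι) (a : ι → ℤ) (A : ℤ)
    (ha : ∀ i ∈ S, |a i| ≤ A) (i : ℕ) :
    |PowerSeries.coeff i (∏ i ∈ S, (1 + PowerSeries.C (a i) * PowerSeries.X))| ≤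
      ((S.card : ℤ) * A) ^ i := by
  classical
  induction S using Finset.induction_on generalizing i with
  | empty =>
    rcases i with _ | i
    · simp
    · simp [PowerSeries.coeff_one]
  | insert b S hb ih =>
    have hA : 0 ≤ A := (abs_nonneg _).trans (ha b (Finset.mem_insert_self _ _))
    have ih' := ih (fun i hi => ha i (Finset.mem_insert_of_mem hi))
    rw [Finset.prod_insert hb, Finset.card_insert_of_notMem hb]
    rcases i with _ | i
    · rw [sv_coeff_zero]; simpa using ih' 0
    · rw [sv_coeff_step]
      set s : ℤ := (S.card : ℤ)
      have hs : 0 ≤ s := by positivity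
      refine (abs_add_le _ _).trans ?_
      rw [abs_mul]
      have h1 := ih' (i + 1)
      have h2 := mul_le_mul (ha b (Finset.mem_insert_self _ _)) (ih' i) (abs_nonneg _) hA
      have h3 : (s * A) ^ (i + 1) + A * (s * A) ^ i ≤ ((s + 1) * A) ^ (i + 1) := by
        have : (s * A) ^ (i + 1) + A * (s * A) ^ i = (s * A) ^ i * ((s + 1) * A) := by ring
        rw [this, pow_succ ((s + 1) * A)]
        gcongr
        linarith
      push_cast
      linarith

theorem sv_eval {ι : Type*} (S : Finset ι) (a : ι → ℤ) (z : ℤ) (k : ℕ) :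
    z ^ (k + 1) ∣ (∏ i ∈ S, (1 + a i * z)) - ∑ i ∈ Finset.range (k + 1),
      PowerSeries.coeff i (∏ i ∈ S, (1 + PowerSeries.C (a i) * PowerSeries.X)) * z ^ i := by
  classical
  induction S using Finset.induction_on with
  | empty =>
    rw [Finset.sum_range_succ']
    simp [PowerSeries.coeff_one]
  | insert b S hb ih =>
    rw [Finset.prod_insert hb, Finset.prod_insert hb]
    set F := ∏ i ∈ S, (1 + PowerSeries.C (a i) * PowerSeries.X)
    rw [Finset.sum_range_succ']
    simp only [sv_coeff_step, sv_coeff_zero]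
    obtain ⟨w, hw⟩ := ih
    have hw' : ∏ i ∈ S, (1 + a i * z) = z ^ (k + 1) * w +
        ∑ i ∈ Finset.range (k + 1), PowerSeries.coeff i F * z ^ i := by linarith
    rw [hw']
    have e1 := Finset.sum_range_succ' (fun i => PowerSeries.coeff i F * z ^ i) k
    have e2 := Finset.sum_range_succ (fun i => PowerSeries.coeff i F * z ^ i) k
    have e3 : ∑ i ∈ Finset.range k, (PowerSeries.coeff (i + 1) F + a b * PowerSeries.coeff i F) * z ^ (i + 1)
        = ∑ i ∈ Finset.range k, PowerSeries.coeff (i + 1) F * z ^ (i + 1) +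
          a b * z * ∑ i ∈ Finset.range k, PowerSeries.coeff i F * z ^ i := by
      rw [Finset.mul_sum, ← Finset.sum_add_distrib]
      exact Finset.sum_congr rfl fun i _ => by ring
    rw [e3]
    refine ⟨(1 + a b * z) * w + a b * PowerSeries.coeff k F, ?_⟩
    set S1 := ∑ i ∈ Finset.range k, PowerSeries.coeff i F * z ^ i
    set S2 := ∑ i ∈ Finset.range k, PowerSeries.coeff (i + 1) F * z ^ (i + 1)
    set S3 := ∑ i ∈ Finset.range (k + 1), PowerSeries.coeff i F * z ^ i
    linear_combination e1 + (a b * z) * e2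

/-- The generating product. -/
noncomputable def svF (q L k : ℕ) (y : Fin L → Fin k → ℤ) : PowerSeries ℤ :=
  ∏ l : Fin L, ∏ j : Fin k,
    (1 + PowerSeries.C (((q : ℕ) : ℤ) ^ (l : ℕ) * y l j) * PowerSeries.X)

theorem svF_eq (q L k : ℕ) (y : Fin L → Fin k → ℤ) :
    svF q L k y = ∏ i : Fin L × Fin k,
      (1 + PowerSeries.C (((q : ℕ) : ℤ) ^ (i.1 : ℕ) * y i.1 i.2) * PowerSeries.X) := by
  rw [svF, Fintype.prod_prod_type]

theorem sv_box_card (k : ℕ) (R : ℕ) (hR : 1 ≤ R) :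
    (Fintype.piFinset (fun i : Fin k => Finset.Icc (-((R : ℤ) ^ ((i : ℕ) + 1))) ((R : ℤ) ^ ((i : ℕ) + 1)))).card
      ≤ 3 ^ k * R ^ (∑ i ∈ Finset.range (k + 1), i) := by
  rw [Fintype.card_piFinset, Finset.sum_range_succ']
  simp only [add_zero]
  rw [← Finset.prod_pow_eq_pow_sum, ← Fin.prod_univ_eq_prod_range (fun i => R ^ (i + 1))]
  rw [show (3:ℕ) ^ k = ∏ i : Fin k, 3 by simp, ← Finset.prod_mul_distrib]
  refine Finset.prod_le_prod' fun i _ => ?_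
  rw [Int.card_Icc]
  have : 1 ≤ R ^ ((i : ℕ) + 1) := Nat.one_le_pow _ _ hR
  zify at this
  rw [Int.toNat_le]
  push_cast
  linarith

theorem sv_exists_phase (z : ℂ) : ∃ θ : ℂ, ‖θ‖ ≤ 1 ∧ θ * z = (‖z‖ : ℂ) := by
  by_cases hz : z = 0
  · exact ⟨0, by simp, by simp [hz]⟩
  · refine ⟨(‖z‖ : ℂ) / z, ?_, ?_⟩
    · rw [norm_div, Complex.norm_real, norm_norm, div_self (norm_ne_zero_iff.2 hz)]
    · exact div_mul_cancel₀ _ hz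

set_option maxHeartbeats 1000000 in
theorem sv_core {N : ℕ} {χ : ℤ → ℂ} (hχ : SvChar N χ) {t k k' u L π d R A : ℕ}
    (hkdef : k = k' + 1) (hπ : π.Prime)
    (hN : N = t * k + u) (hu : 1 ≤ u) (hut : u ≤ t) (hk : Odd k)
    (𝒜 : Finset ℕ) (ζ : ℕ → ℤ) (hζ : ∀ α ∈ 𝒜, Odd (ζ α))
    (hinj : ∀ α ∈ 𝒜, ∀ α' ∈ 𝒜, α ≠ α' → ¬ (2 ^ u : ℤ) ∣ ζ α - ζ α')
    (Y : Fin L → Fin k → Finset ℤ) (c : Fin L → ℕ)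
    (hY1 : ∀ l i j, j ≠ i → ∀ a ∈ Y l j, ∀ b ∈ Y l i, ¬ (π:ℤ) ∣ a - b)
    (hY2 : ∀ l j, ∀ r:ℤ, ((Y l j).filter (fun y => (((π^d)^k : ℕ):ℤ) ∣ y - r)).card ≤ c l)
    (hY3 : ∀ l j, ∀ y ∈ Y l j, |((π ^ d : ℕ) : ℤ) ^ (l : ℕ) * y| ≤ A)
    (hR : L * k * A ≤ R) (hR1 : 1 ≤ R) (hRu : R ^ k < 2 ^ (u - 1))
    (δ : Fin L → ℝ) (hδ : ∀ l, 0 ≤ δ l)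
    (hbig : ∀ α ∈ 𝒜, ∀ l j, δ l ≤
      ‖∑ y ∈ Y l j, χ (1 + ((π ^ d : ℕ) : ℤ) ^ (l : ℕ) * y * (2 ^ t * ζ α))‖) :
    (𝒜.card : ℝ) * (∏ l, δ l ^ k) ^ 2 ≤
      (∏ l, ∏ j, ((Y l j).card : ℝ)) *
      ((∏ l, (c l ^ k * (π^d)^(∑ i ∈ Finset.range k, i)) : ℕ) : ℝ) *
      ((3 ^ k' * R ^ (∑ i ∈ Finset.range k, i) : ℕ) : ℝ) * 2 ^ u := by
  classical
  set q := π ^ d with hq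
  set PP := Fintype.piFinset (fun l => Fintype.piFinset (Y l)) with hPP
  set z : ℕ → ℤ := fun α => 2 ^ t * ζ α with hz
  set P : (Fin L → Fin k → ℤ) → ℕ → ℤ := fun y α => ∏ i : Fin L × Fin k, (1 + (q : ℤ) ^ (i.1 : ℕ) * y i.1 i.2 * z α) with hP
  let χ' : ℤ →* ℂ := { toFun := χ, map_one' := hχ.one, map_mul' := hχ.mul }
  have hχ' : ∀ x, χ x = χ' x := fun x => rfl
  have hprod : ∀ α, ∏ l, ∏ j, ∑ y ∈ Y l j, χ (1 + (q : ℤ) ^ (l : ℕ) * y * z α) =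
      ∑ y ∈ PP, χ (P y α) := by
    intro α
    have h1 : ∀ l, ∏ j, ∑ y ∈ Y l j, χ (1 + (q : ℤ) ^ (l : ℕ) * y * z α) =
        ∑ y ∈ Fintype.piFinset (Y l), ∏ j, χ (1 + (q : ℤ) ^ (l : ℕ) * y j * z α) := fun l =>
      Finset.prod_univ_sum _ _
    simp only [h1]
    rw [Finset.prod_univ_sum]
    refine Finset.sum_congr rfl fun y _ => ?_
    simp only [hP, hχ', map_prod, Fintype.prod_prod_type]
  set F : ℕ → ℂ := fun α => ∑ y ∈ PP, χ (P y α) with hF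
  set D := ∏ l, δ l ^ k with hD
  have hD0 : 0 ≤ D := Finset.prod_nonneg fun l _ => pow_nonneg (hδ l) _
  have hFD : ∀ α ∈ 𝒜, D ≤ ‖F α‖ := by
    intro α hα
    simp only [hF]
    rw [← hprod, norm_prod]
    refine Finset.prod_le_prod (fun l _ => pow_nonneg (hδ l) _) fun l _ => ?_
    rw [norm_prod]
    calc δ l ^ k = ∏ j : Fin k, δ l := by simp
      _ ≤ _ := Finset.prod_le_prod (fun _ _ => hδ l) fun j _ => hbig α hα l j
  choose θ hθ1 hθ2 using fun α => sv_exists_phase (F α)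
  set G : (Fin L → Fin k → ℤ) → ℂ := fun y => ∑ α ∈ 𝒜, θ α * χ (P y α) with hG
  have hsum : (𝒜.card : ℝ) * D ≤ ∑ y ∈ PP, ‖G y‖ := by
    have h1 : (𝒜.card : ℝ) * D ≤ ∑ α ∈ 𝒜, ‖F α‖ := by
      rw [← nsmul_eq_mul]; exact Finset.card_nsmul_le_sum _ _ _ hFD
    have h2 : ((∑ α ∈ 𝒜, ‖F α‖ : ℝ) : ℂ) = ∑ y ∈ PP, G y := by
      push_cast
      simp only [hG]
      rw [Finset.sum_comm]
      exact Finset.sum_congr rfl fun α _ => by rw [← hθ2, hF, Finset.mul_sum]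
    have h3 : ∑ α ∈ 𝒜, ‖F α‖ = ‖∑ y ∈ PP, G y‖ := by
      rw [← h2, Complex.norm_real, Real.norm_of_nonneg (Finset.sum_nonneg fun _ _ => norm_nonneg _)]
    rw [h3] at h1
    exact h1.trans (norm_sum_le _ _)
  have hCS : (∑ y ∈ PP, ‖G y‖) ^ 2 ≤ (PP.card : ℝ) * ∑ y ∈ PP, ‖G y‖ ^ 2 := sq_sum_le_card_mul_sum_sq
  have hcardPP : (PP.card : ℝ) = ∏ l, ∏ j, ((Y l j).card : ℝ) := by
    rw [hPP, Fintype.card_piFinset]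
    push_cast
    exact Finset.prod_congr rfl fun l _ => by rw [Fintype.card_piFinset]; push_cast; rfl
  set Mult := ∏ l, (c l ^ k * q ^ (∑ i ∈ Finset.range k, i)) with hMult
  set Box := Fintype.piFinset (fun i : Fin k' => Finset.Icc (-((R : ℤ) ^ ((i : ℕ) + 1))) ((R : ℤ) ^ ((i : ℕ) + 1))) with hBox
  set J := Finset.Ico (-(2 ^ (u - 1) : ℤ)) (-(2 ^ (u - 1) : ℤ) + (2 ^ u : ℕ)) with hJ
  set Φ : (Fin L → Fin k → ℤ) → (Fin k' → ℤ) × ℤ := fun y =>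
    (fun i => PowerSeries.coeff ((i : ℕ) + 1) (svF q L k y), PowerSeries.coeff k (svF q L k y)) with hΦ
  have hcoef : ∀ y ∈ PP, ∀ i, |PowerSeries.coeff i (svF q L k y)| ≤ (R : ℤ) ^ i := by
    intro y hy i
    rw [svF_eq]
    refine (sv_coeff_bound Finset.univ _ (A : ℤ) ?_ i).trans ?_
    · rintro ⟨l, j⟩ _
      simp only [hPP, Fintype.mem_piFinset] at hy
      exact hY3 l j _ (hy l j)
    · refine pow_le_pow_left₀ (by positivity) ?_ _
      simp only [Finset.card_univ, Fintype.card_prod, Fintype.card_fin]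
      exact_mod_cast hR
  have hmaps : ∀ y ∈ PP, Φ y ∈ Box ×ˢ J := by
    intro y hy
    rw [Finset.mem_product]
    refine ⟨?_, ?_⟩
    · rw [hBox, Fintype.mem_piFinset]
      intro i
      rw [Finset.mem_Icc]
      exact abs_le.1 (hcoef y hy _)
    · have h1 := abs_le.1 (hcoef y hy k)
      have h2 : (R : ℤ) ^ k < 2 ^ (u - 1) := by exact_mod_cast hRu
      have h3 : (2 : ℤ) ^ u = 2 * 2 ^ (u - 1) := by
        rw [← pow_succ']; congr 1; omega
      rw [hJ, Finset.mem_Ico]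
      push_cast
      rw [h3]
      simp only [hΦ]
      constructor <;> linarith
  set Q : (Fin k' → ℤ) → ℕ → ℤ := fun μ α => 1 + ∑ i : Fin k', μ i * z α ^ ((i : ℕ) + 1) with hQ
  set g : (Fin k' → ℤ) × ℤ → ℂ := fun w => ∑ α ∈ 𝒜, θ α * χ (Q w.1 α + w.2 * (2 ^ t * ζ α) ^ k) with hg
  have hGg : ∀ y, G y = g (Φ y) := by
    intro y
    simp only [hG, hg]
    refine Finset.sum_congr rfl fun α _ => ?_
    congr 1
    apply hχ.per
    have h1 := sv_eval (Finset.univ : Finset (Fin L × Fin k)) (fun i => (q : ℤ) ^ (i.1 : ℕ) * y i.1 i.2) (z α) k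
    rw [← svF_eq] at h1
    have h2 : (2 ^ N : ℤ) ∣ z α ^ (k + 1) := by
      simp only [hz]
      rw [mul_pow, ← pow_mul]
      refine Dvd.dvd.mul_right (pow_dvd_pow _ ?_) _
      rw [hN]; nlinarith
    refine (h2.trans h1).trans (dvd_of_eq ?_)
    simp only [hP, hQ, hΦ]
    congr 1
    subst hkdef
    rw [Finset.sum_range_succ, Finset.sum_range_succ',
      ← Fin.sum_univ_eq_sum_range (fun i => PowerSeries.coeff (i + 1) (svF q L (k' + 1) y) * z α ^ (i + 1))]
    have h0 : PowerSeries.coeff 0 (svF q L (k' + 1) y) = 1 := by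
      rw [svF_eq]; exact sv_coeff_zero_prod _ _
    rw [h0]
    simp only [hz]
    ring
  have hfib : ∀ w ∈ Box ×ˢ J, (PP.filter (fun y => Φ y = w)).card ≤ Mult := by
    intro w _
    rcases (PP.filter (fun y => Φ y = w)).eq_empty_or_nonempty with he | ⟨y0, hy0⟩
    · rw [he]; simp
    · have hy0' := (Finset.mem_filter.1 hy0).2
      refine sv_mult hπ L Y c hY1 hY2 (svF q L k y0) _ (Finset.filter_subset _ _) ?_
      intro y hy
      have hy' := (Finset.mem_filter.1 hy).2
      have hyy : Φ y = Φ y0 := hy'.trans hy0'.symm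
      simp only [hΦ, Prod.mk.injEq] at hyy
      change PowerSeries.X ^ (k + 1) ∣ svF q L k y - svF q L k y0
      rw [PowerSeries.X_pow_dvd_iff]
      intro m hm
      rw [map_sub, sub_eq_zero]
      rcases m with _ | m
      · rw [svF_eq, svF_eq, sv_coeff_zero_prod, sv_coeff_zero_prod]
      · rcases Nat.lt_or_ge m k' with h | h
        · exact congrFun hyy.1 ⟨m, h⟩
        · have : m + 1 = k := by omega
          rw [this]; exact hyy.2
  have hsq : ∑ y ∈ PP, ‖G y‖ ^ 2 ≤ (Mult : ℝ) * ((Box.card : ℝ) * (2 ^ u * 𝒜.card)) := by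
    calc ∑ y ∈ PP, ‖G y‖ ^ 2 = ∑ y ∈ PP, ‖g (Φ y)‖ ^ 2 := by simp only [hGg]
      _ = ∑ w ∈ Box ×ˢ J, ∑ y ∈ PP with Φ y = w, ‖g (Φ y)‖ ^ 2 :=
        (Finset.sum_fiberwise_of_maps_to hmaps _).symm
      _ ≤ ∑ w ∈ Box ×ˢ J, (Mult : ℝ) * ‖g w‖ ^ 2 := by
        refine Finset.sum_le_sum fun w hw => ?_
        calc ∑ y ∈ PP with Φ y = w, ‖g (Φ y)‖ ^ 2 = ∑ y ∈ PP with Φ y = w, ‖g w‖ ^ 2 := by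
              refine Finset.sum_congr rfl fun y hy => ?_
              rw [(Finset.mem_filter.1 hy).2]
          _ = ((PP.filter (fun y => Φ y = w)).card : ℝ) * ‖g w‖ ^ 2 := by
              rw [Finset.sum_const, nsmul_eq_mul]
          _ ≤ _ := by
              gcongr
              exact hfib w hw
      _ = (Mult : ℝ) * ∑ μ ∈ Box, ∑ ν ∈ J, ‖g (μ, ν)‖ ^ 2 := by
        rw [← Finset.mul_sum, Finset.sum_product]
      _ ≤ (Mult : ℝ) * ∑ μ ∈ Box, (2 ^ u * (𝒜.card : ℝ)) := by
        gcongr with μ hμ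
        refine sv_sieve hχ hN hu hut hk 𝒜 ζ θ (Q μ) (fun α _ => hθ1 α) ?_ hζ hinj _
        intro α _
        simp only [hQ, add_sub_cancel_left]
        refine Finset.dvd_sum fun i _ => ?_
        refine Dvd.dvd.mul_left ?_ _
        exact (Dvd.intro _ rfl : (2 ^ t : ℤ) ∣ z α).trans (dvd_pow_self _ (by omega))
      _ = _ := by rw [Finset.sum_const, nsmul_eq_mul]
  have hboxc : (Box.card : ℝ) ≤ ((3 ^ k' * R ^ (∑ i ∈ Finset.range k, i) : ℕ) : ℝ) := by
    rw [hkdef]; exact_mod_cast sv_box_card k' R hR1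
  rcases Nat.eq_zero_or_pos 𝒜.card with h0 | h0
  · rw [h0, Nat.cast_zero, zero_mul]
    exact mul_nonneg (mul_nonneg (mul_nonneg (Finset.prod_nonneg fun _ _ =>
      Finset.prod_nonneg fun _ _ => Nat.cast_nonneg _) (Nat.cast_nonneg _)) (Nat.cast_nonneg _))
      (pow_nonneg zero_le_two _)
  have h0' : (0 : ℝ) < 𝒜.card := by exact_mod_cast h0
  have hfin : ((𝒜.card : ℝ) * D) ^ 2 ≤ (PP.card : ℝ) * ((Mult : ℝ) * ((Box.card : ℝ) * (2 ^ u * 𝒜.card))) :=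
    (pow_le_pow_left₀ (mul_nonneg h0'.le hD0) hsum 2).trans
      (hCS.trans (mul_le_mul_of_nonneg_left hsq (Nat.cast_nonneg _)))
  rw [← hcardPP]
  have h5 : (𝒜.card : ℝ) * D ^ 2 ≤ (PP.card : ℝ) * Mult * Box.card * 2 ^ u := by
    refine le_of_mul_le_mul_right ?_ h0'
    calc _ = ((𝒜.card : ℝ) * D) ^ 2 := by ring
      _ ≤ _ := hfin
      _ = _ := by ring
  refine h5.trans ?_
  refine mul_le_mul_of_nonneg_right ?_ (pow_nonneg zero_le_two _)
  exact mul_le_mul_of_nonneg_left hboxc (mul_nonneg (Nat.cast_nonneg _) (Nat.cast_nonneg _))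

theorem sv_card_cong (M K : ℕ) (S : Finset ℕ) (hS : ∀ y ∈ S, y < M * K)
    (hc : ∀ y ∈ S, ∀ y' ∈ S, (M : ℤ) ∣ (y : ℤ) - y') : S.card ≤ K := by
  have : S.card ≤ (Finset.range K).card := by
    refine Finset.card_le_card_of_injOn (fun y => y / M) ?_ ?_
    · intro y hy
      simp only [Finset.coe_range, Set.mem_Iio]
      exact Nat.div_lt_of_lt_mul (hS y hy)
    · intro y hy y' hy' h
      have h1 : y' % M = y % M := (Nat.modEq_iff_dvd.2 (hc y hy y' hy'))
      simp only at h
      rw [← Nat.div_add_mod y M, ← Nat.div_add_mod y' M, h, h1]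
  simpa using this

/-- One cell of the grid. -/
def svCell (π B c : ℕ) (g : ℤ) : Finset ℤ :=
  (Finset.range B).image (fun y : ℕ => (c : ℤ) + π * (y : ℤ) - g)

theorem svCell_inj (π c : ℕ) (hπ : 0 < π) (g : ℤ) :
    Function.Injective (fun y : ℕ => (c : ℤ) + π * (y : ℤ) - g) := by
  intro a b h
  have hπ' : (π : ℤ) ≠ 0 := by exact_mod_cast hπ.ne'
  have : (π : ℤ) * a = π * b := by simp only at h; linarith
  exact_mod_cast mul_left_cancel₀ hπ' this

theorem svCell_card (π B c : ℕ) (hπ : 0 < π) (g : ℤ) : (svCell π B c g).card = B := by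
  rw [svCell, Finset.card_image_of_injective _ (svCell_inj π c hπ g), Finset.card_range]

theorem svCell_cong (π B c M K : ℕ) (hπ : 0 < π) (g : ℤ) (hB : B = M * K) (r : ℤ) :
    ((svCell π B c g).filter (fun y => ((π * M : ℕ) : ℤ) ∣ y - r)).card ≤ K := by
  rw [svCell, Finset.filter_image, Finset.card_image_of_injective _ (svCell_inj π c hπ g)]
  refine sv_card_cong M K _ ?_ ?_
  · intro y hy
    rw [← hB]
    exact Finset.mem_range.1 (Finset.mem_filter.1 hy).1
  · intro y hy y' hy'
    have h1 := (Finset.mem_filter.1 hy).2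
    have h2 := (Finset.mem_filter.1 hy').2
    have h3 := dvd_sub h1 h2
    have hπ' : (π : ℤ) ≠ 0 := by exact_mod_cast hπ.ne'
    rw [show (c : ℤ) + π * (y : ℤ) - g - r - (c + π * (y' : ℤ) - g - r) = π * ((y : ℤ) - y') by ring] at h3
    push_cast at h3
    exact (mul_dvd_mul_iff_left hπ').1 h3

theorem svCell_disj (π B B' c c' : ℕ) (hc : c < π) (hc' : c' < π) (hne : c ≠ c') (g : ℤ) :
    ∀ a ∈ svCell π B c g, ∀ b ∈ svCell π B' c' g, ¬ (π : ℤ) ∣ a - b := by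
  intro a ha b hb hd
  obtain ⟨y, _, rfl⟩ := Finset.mem_image.1 ha
  obtain ⟨y', _, rfl⟩ := Finset.mem_image.1 hb
  rw [show (c : ℤ) + π * (y : ℤ) - g - (c' + π * (y' : ℤ) - g) = ((c : ℤ) - c') + π * ((y : ℤ) - y') by ring] at hd
  rw [dvd_add_left (Dvd.intro _ rfl)] at hd
  have h2 : c' % π = c % π := Nat.modEq_iff_dvd.2 hd
  rw [Nat.mod_eq_of_lt hc, Nat.mod_eq_of_lt hc'] at h2
  exact hne h2.symm

theorem svCell_abs (π B c g E : ℕ) (hc : c < π) (hB : π * B ≤ E) (hg : g ≤ E) :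
    ∀ a ∈ svCell π B c g, |a| ≤ E := by
  intro a ha
  obtain ⟨y, hy, rfl⟩ := Finset.mem_image.1 ha
  rw [Finset.mem_range] at hy
  have h1 : c + π * y ≤ E := by
    calc c + π * y ≤ π + π * y := by omega
      _ = π * (y + 1) := by ring
      _ ≤ π * B := Nat.mul_le_mul_left _ hy
      _ ≤ E := hB
  zify at h1 hg
  have h2 : (0:ℤ) ≤ c + π * y := by positivity
  have h3 : (0:ℤ) ≤ g := by positivity
  rw [abs_le]; constructor <;> linarith

theorem sv_inv {N : ℕ} {w : ℤ} (hw : Odd w) : ∃ v : ℤ, (2 ^ N : ℤ) ∣ w * v - 1 := by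
  obtain ⟨m, hm⟩ := hw
  have h : IsCoprime w (2 ^ N : ℤ) := IsCoprime.pow_right ⟨1, -m, by rw [hm]; ring⟩
  obtain ⟨a, b, hab⟩ := h
  exact ⟨a, -b, by linear_combination hab⟩

set_option maxHeartbeats 1000000 in
theorem sv_fiber {N : ℕ} {χ : ℤ → ℂ} (hχ : SvChar N χ) {t k k' u L π d R : ℕ}
    (hkdef : k = k' + 1) (hπ : π.Prime) (hd : 0 < d)
    (hN : N = t * k + u) (hu : 1 ≤ u) (hut : u ≤ t) (hk : Odd k)
    (hR : L * k * (π ^ d) ^ (L + k) ≤ R) (hR1 : 1 ≤ R) (hRu : R ^ k < 2 ^ (u - 1))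
    (x : ℤ) (hx : Odd x) (𝒜 : Finset ℕ)
    (β : ℕ) (hβ : β < (π ^ d) ^ L) (c : Fin L → Fin k → Fin π) (hc : ∀ l, Function.Injective (c l))
    (h𝒜 : ∀ α ∈ 𝒜, α < 2 ^ u ∧ Odd α ∧
      ∀ (l : Fin L) (j : Fin k), (1 / (π : ℝ)) * ((π ^ (d * (L + k - l) - 1) : ℕ) : ℝ) ≤
        ‖∑ y ∈ Finset.range (π ^ (d * (L + k - l) - 1)),
          χ (x + 2 ^ t * α * ((β % (π ^ d) ^ (l : ℕ) + (π ^ d) ^ (l : ℕ) * ((c l j : ℕ) + π * y) : ℕ) : ℤ))‖) :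
    𝒜.card * (π ^ d) ^ (k * k * L) ≤ 2 ^ u * π ^ (3 * k * L) *
      (π ^ d) ^ (L * ∑ i ∈ Finset.range k, i) * 3 ^ k' * R ^ (∑ i ∈ Finset.range k, i) := by
  have hπ0 : 0 < π := hπ.pos
  have ht1 : 1 ≤ t := hu.trans hut
  have hwodd : ∀ α : ℕ, Odd (x + 2 ^ t * (α : ℤ) * β) := by
    intro α
    refine hx.add_even ?_
    rw [mul_assoc]
    exact Even.mul_right (Even.pow_of_ne_zero even_two (by omega)) _
  choose v hv using fun α : ℕ => sv_inv (N := N) (hwodd α)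
  set B : Fin L → ℕ := fun l => π ^ (d * (L + k - l) - 1) with hB
  set g : Fin L → ℕ := fun l => β / (π ^ d) ^ (l : ℕ) with hg
  set Y : Fin L → Fin k → Finset ℤ := fun l j => svCell π (B l) (c l j : ℕ) (g l : ℤ) with hY
  set T := ∑ i ∈ Finset.range k, i with hT
  have hB1 : ∀ l, π * B l = (π ^ d) ^ (L + k - l) := by
    intro l
    have hpos : 1 ≤ d * (L + k - l) := Nat.mul_pos hd (by have := l.2; omega)
    simp only [hB]
    rw [← pow_succ', ← pow_mul]; congr 1; omega
  have hk1 : 1 ≤ k := by omega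
  have key := sv_core hχ (t := t) (k := k) (k' := k') (u := u) (L := L) (π := π) (d := d) (R := R)
    (A := (π ^ d) ^ (L + k)) hkdef hπ hN hu hut hk 𝒜 (fun α => α * v α) ?_ ?_ Y
    (fun l => (π ^ d) ^ (L - l)) ?_ ?_ ?_ hR hR1 hRu (fun l => (1 / (π : ℝ)) * (B l : ℝ)) ?_ ?_
  rotate_left
  · intro α hα
    have h1 : Odd (α : ℤ) := by exact_mod_cast (h𝒜 α hα).2.1
    refine h1.mul ?_
    have h2 : (2 : ℤ) ∣ (x + 2 ^ t * (α : ℤ) * β) * v α - 1 :=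
      (dvd_pow_self 2 (by rw [hN]; omega)).trans (hv α)
    have h3 : Odd ((x + 2 ^ t * (α : ℤ) * β) * v α) := by
      obtain ⟨e, he⟩ := h2
      exact ⟨e, by linarith⟩
    exact (Int.odd_mul.1 h3).2
  · intro α hα α' hα' hne hdvd
    have hv' : ∀ α : ℕ, (2 ^ u : ℤ) ∣ x * v α - 1 := by
      intro α
      have h1 : (2 ^ u : ℤ) ∣ (x + 2 ^ t * (α : ℤ) * β) * v α - 1 :=
        (pow_dvd_pow _ (by rw [hN]; omega)).trans (hv α)
      have h2 : (2 ^ u : ℤ) ∣ 2 ^ t * (α : ℤ) * β * v α := by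
        rw [mul_assoc, mul_assoc]
        exact (pow_dvd_pow _ hut).mul_right _
      have h3 := dvd_sub h1 h2
      rwa [show (x + 2 ^ t * (α : ℤ) * β) * v α - 1 - 2 ^ t * (α : ℤ) * β * v α = x * v α - 1 by ring] at h3
    have h1 := hdvd.mul_left x
    have h2 := (hv' α).mul_left α
    have h3 := (hv' α').mul_left α'
    have h4 := dvd_add (dvd_sub h1 h2) h3
    rw [show x * (α * v α - α' * v α') - α * (x * v α - 1) + α' * (x * v α' - 1) = (α : ℤ) - α' by ring] at h4
    have h5 : α' % 2 ^ u = α % 2 ^ u := Nat.modEq_iff_dvd.2 (by exact_mod_cast h4)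
    rw [Nat.mod_eq_of_lt (h𝒜 α hα).1, Nat.mod_eq_of_lt (h𝒜 α' hα').1] at h5
    exact hne h5.symm
  · intro l i j hij
    exact svCell_disj _ _ _ _ _ (c l j).2 (c l i).2 (fun h => hij (hc l (Fin.ext h))) _
  · intro l j r
    have h1 := svCell_cong π (B l) (c l j : ℕ) (π ^ (d * k - 1)) ((π ^ d) ^ (L - l)) hπ0 (g l) ?_ r
    · have e : π * π ^ (d * k - 1) = (π ^ d) ^ k := by
        have hpos : 1 ≤ d * k := Nat.mul_pos hd hk1
        rw [← pow_succ', ← pow_mul]; congr 1; omega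
      rw [e] at h1
      exact h1
    · simp only [hB]
      rw [← pow_mul, ← pow_add]
      congr 1
      have hpos : 1 ≤ d * k := Nat.mul_pos hd hk1
      have : L + k - l = k + (L - l) := by have := l.2; omega
      rw [this, mul_add]; omega
  · intro l j y hy
    have h1 := svCell_abs π (B l) (c l j : ℕ) (g l) ((π ^ d) ^ (L + k - l)) (c l j).2 (hB1 l).le ?_ y hy
    · rw [abs_mul, abs_of_nonneg (by positivity)]
      calc _ ≤ ((π ^ d : ℕ) : ℤ) ^ (l : ℕ) * (((π ^ d) ^ (L + k - l) : ℕ) : ℤ) := by gcongr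
        _ = _ := by
          push_cast
          rw [← pow_add]; congr 1; have := l.2; omega
    · simp only [hg]
      refine (Nat.div_lt_of_lt_mul ?_).le
      rw [← pow_add]
      refine hβ.trans_le (Nat.pow_le_pow_right (pow_pos hπ0 _) ?_)
      have := l.2; omega
  · intro l; positivity
  · intro α hα l j
    refine ((h𝒜 α hα).2.2 l j).trans (le_of_eq ?_)
    rw [hY]
    simp only
    rw [svCell, Finset.sum_image (fun a _ b _ h => svCell_inj π _ hπ0 _ h)]
    have h1 : ‖χ (x + 2 ^ t * (α : ℤ) * β)‖ = 1 := hχ.norm_odd _ (hwodd α)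
    refine Eq.trans ?_ (one_mul _)
    rw [← h1, ← norm_mul, Finset.mul_sum]
    congr 1
    refine Finset.sum_congr rfl fun y _ => ?_
    rw [← hχ.mul]
    apply hχ.per
    obtain ⟨e, he⟩ := hv α
    set w := x + 2 ^ t * (α : ℤ) * β with hw
    have hmod : (β : ℤ) = ((β % (π ^ d) ^ (l : ℕ) : ℕ) : ℤ) + ((π ^ d : ℕ) : ℤ) ^ (l : ℕ) * (g l : ℤ) := by
      simp only [hg]
      exact_mod_cast (Nat.mod_add_div β ((π ^ d) ^ (l : ℕ))).symm
    set r := ((β % (π ^ d) ^ (l : ℕ) : ℕ) : ℤ)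
    refine ⟨-(e * (((π ^ d : ℕ) : ℤ) ^ (l : ℕ) * (((c l j : ℕ) : ℤ) + π * y - g l) * (2 ^ t * α))), ?_⟩
    have e1 : ((β % (π ^ d) ^ (l : ℕ) + (π ^ d) ^ (l : ℕ) * ((c l j : ℕ) + π * y) : ℕ) : ℤ) =
        r + ((π ^ d : ℕ) : ℤ) ^ (l : ℕ) * (((c l j : ℕ) : ℤ) + π * y) := by
      simp only [r]; push_cast; ring
    rw [e1]
    set q := ((π ^ d : ℕ) : ℤ) ^ (l : ℕ)
    set s := ((c l j : ℕ) : ℤ) + π * (y : ℤ)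
    have hw2 : w = x + 2 ^ t * (α : ℤ) * (r + q * g l) := by rw [hw, ← hmod]
    have hx2 : x = w - 2 ^ t * (α : ℤ) * (r + q * g l) := by rw [hw2]; ring
    rw [hx2]
    linear_combination (-(q * (s - g l) * (2 ^ t * α))) * he
  -- numerics
  simp only [hY, svCell_card _ _ _ hπ0, Finset.prod_const, Finset.card_univ, Fintype.card_fin] at key
  have hπR : (0 : ℝ) < π := by exact_mod_cast hπ0
  have hBpos : ∀ l, (0 : ℝ) < B l := fun l => by
    have : 0 < B l := pow_pos hπ0 _
    exact_mod_cast this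
  set W : ℝ := ∏ l, (B l : ℝ) ^ k with hW
  have hWpos : 0 < W := Finset.prod_pos fun l _ => pow_pos (hBpos l) _
  have e1 : ∏ l, ((1 / (π : ℝ)) * (B l : ℝ)) ^ k = (1 / (π : ℝ)) ^ (k * L) * W := by
    simp only [mul_pow]
    rw [Finset.prod_mul_distrib, Finset.prod_const, Finset.card_univ, Fintype.card_fin, ← pow_mul]
  rw [e1] at key
  have e2 : (((∏ l : Fin L, (((π ^ d) ^ (L - (l:ℕ))) ^ k * (π ^ d) ^ T)) : ℕ) : ℝ) * ((π : ℝ) ^ d) ^ (k * k * L)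
      = W * (π : ℝ) ^ (k * L) * ((π : ℝ) ^ d) ^ (L * T) := by
    have hl : ∀ l : Fin L, (((π : ℝ) ^ d) ^ (L - (l:ℕ))) ^ k * ((π : ℝ) ^ d) ^ (k * k) = (B l : ℝ) ^ k * (π : ℝ) ^ k := by
      intro l
      have h1 : (π : ℝ) * B l = ((π : ℝ) ^ d) ^ (L + k - l) := by exact_mod_cast hB1 l
      rw [← mul_pow, mul_comm (B l : ℝ), h1]
      simp only [← pow_mul, ← pow_add]
      congr 1
      have : L + k - l = (L - l) + k := by have := l.2; omega
      rw [this]; ring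
    have h2 := Finset.prod_congr (rfl : (Finset.univ : Finset (Fin L)) = Finset.univ) (fun l _ => hl l)
    rw [Finset.prod_mul_distrib, Finset.prod_mul_distrib, ← hW] at h2
    simp only [Finset.prod_const, Finset.card_univ, Fintype.card_fin, ← pow_mul] at h2
    rw [Finset.prod_mul_distrib]
    push_cast
    simp only [Finset.prod_const, Finset.card_univ, Fintype.card_fin, ← pow_mul] at h2 ⊢
    rw [mul_right_comm, ← mul_assoc d (k * k) L, h2]
    ring
  have hfin : (𝒜.card : ℝ) * ((π : ℝ) ^ d) ^ (k * k * L) ≤ 2 ^ u * (π : ℝ) ^ (3 * k * L) *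
      ((π : ℝ) ^ d) ^ (L * T) * 3 ^ k' * (R : ℝ) ^ T := by
    set M : ℝ := (((∏ l : Fin L, (((π ^ d) ^ (L - (l:ℕ))) ^ k * (π ^ d) ^ T)) : ℕ) : ℝ)
    set K : ℝ := ((π : ℝ) ^ d) ^ (k * k * L)
    have hK : 0 < K := by positivity
    have h1 : (𝒜.card : ℝ) * ((1 / (π : ℝ)) ^ (k * L) * W) ^ 2 * K ≤
        W * (W * (π : ℝ) ^ (k * L) * ((π : ℝ) ^ d) ^ (L * T)) * ((3 ^ k' * R ^ T : ℕ) : ℝ) * 2 ^ u := by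
      rw [← e2]
      calc _ ≤ _ := mul_le_mul_of_nonneg_right key hK.le
        _ = _ := by ring
    have h2 : (1 / (π : ℝ)) ^ (k * L) * (π : ℝ) ^ (k * L) = 1 := by
      rw [← mul_pow, one_div_mul_cancel hπR.ne', one_pow]
    have hX : 0 < (π : ℝ) ^ (k * L) := by positivity
    have h3 : (𝒜.card : ℝ) * K * W ^ 2 ≤ (2 ^ u * ((π : ℝ) ^ (k * L)) ^ 3 *
      ((π : ℝ) ^ d) ^ (L * T) * 3 ^ k' * (R : ℝ) ^ T) * W ^ 2 := by
      calc (𝒜.card : ℝ) * K * W ^ 2 = ((𝒜.card : ℝ) * ((1 / (π : ℝ)) ^ (k * L) * W) ^ 2 * K) * ((π : ℝ) ^ (k * L)) ^ 2 := by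
            linear_combination (-(𝒜.card : ℝ) * K * W ^ 2 * ((1 / (π : ℝ)) ^ (k * L) * (π : ℝ) ^ (k * L) + 1)) * h2
        _ ≤ _ := mul_le_mul_of_nonneg_right h1 (by positivity)
        _ = _ := by push_cast; ring
    have h4 := le_of_mul_le_mul_right h3 (by positivity)
    rwa [← pow_mul, show k * L * 3 = 3 * k * L by ring] at h4
  exact_mod_cast hfin

theorem sv_dense {N : ℕ} {χ : ℤ → ℂ} (hχ : SvChar N χ) {t k u π : ℕ}
    (hπ : π.Prime) (h3 : 3 ≤ π) (hk3 : 3 ≤ k) (hk : Odd k) (hkπ : k ^ 3 ≤ π)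
    (hN : N = t * k + u) (hu : 1 ≤ u) (hut : u ≤ t)
    (hRu : (k ^ 3 * (π ^ 20) ^ (k ^ 2 + k)) ^ k < 2 ^ (u - 1))
    (x : ℤ) (hx : Odd x) (𝒜 : Finset ℕ)
    (h𝒜 : ∀ α ∈ 𝒜, α < 2 ^ u ∧ Odd α ∧
      (2 * k / (π : ℝ)) * (((π ^ 20) ^ (k ^ 2 + k) : ℕ) : ℝ) ≤
        ‖∑ b ∈ Finset.range ((π ^ 20) ^ (k ^ 2 + k)), χ (x + 2 ^ t * α * (b : ℤ))‖) :
    𝒜.card * π ≤ 2 ^ u := by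
  classical
  have hπ0 : 0 < π := hπ.pos
  have hπR : (0 : ℝ) < π := by exact_mod_cast hπ0
  set L := k ^ 2 with hL
  set R := k ^ 3 * (π ^ 20) ^ (L + k) with hR
  set T := ∑ i ∈ Finset.range k, i with hT
  obtain ⟨k', hk'⟩ : ∃ k', k = k' + 1 := ⟨k - 1, by omega⟩
  let Dt := Fin ((π ^ 20) ^ L) × (Fin L → Fin k → Fin π)
  let Good : ℕ → Dt → Prop := fun α w => (∀ l, Function.Injective (w.2 l)) ∧
      ∀ (l : Fin L) (j : Fin k), (1 / (π : ℝ)) * ((π ^ (20 * (L + k - l) - 1) : ℕ) : ℝ) ≤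
        ‖∑ y ∈ Finset.range (π ^ (20 * (L + k - l) - 1)),
          χ (x + 2 ^ t * α * (((w.1 : ℕ) % (π ^ 20) ^ (l : ℕ) + (π ^ 20) ^ (l : ℕ) * ((w.2 l j : ℕ) + π * y) : ℕ) : ℤ))‖
  have hnorm : ∀ y, ‖χ y‖ ≤ 1 := by
    intro y
    rcases Int.even_or_odd y with h | h
    · rw [hχ.even_zero y h]; simp
    · exact (hχ.norm_odd y h).le
  have hex : ∀ α ∈ 𝒜, ∃ w : Dt, Good α w := by
    intro α hα
    obtain ⟨β, c, hc, hb⟩ := sv_chain (fun b => χ (x + 2 ^ t * α * (b : ℤ))) (fun y => hnorm _) π 20 L k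
      (2 * k / (π : ℝ)) hπ0 (by norm_num) (by omega)
      (le_of_eq (by field_simp)) (h𝒜 α hα).2.2
    refine ⟨(β, c), hc, fun l j => le_trans ?_ (hb l j)⟩
    have h1 : (1 : ℝ) ≤ k := by exact_mod_cast (by omega : 1 ≤ k)
    refine mul_le_mul_of_nonneg_right ?_ (Nat.cast_nonneg _)
    rw [show 2 * (k : ℝ) / π / 2 = k / π by ring]
    gcongr
  set K := 2 ^ u * π ^ (3 * k * L) * (π ^ 20) ^ (L * T) * 3 ^ k' * R ^ T with hK
  have hfib : ∀ w : Dt, (𝒜.filter (fun α => Good α w)).card * (π ^ 20) ^ (k * k * L) ≤ K := by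
    intro w
    rcases (𝒜.filter (fun α => Good α w)).eq_empty_or_nonempty with he | ⟨α0, hα0⟩
    · rw [he]; simp
    refine sv_fiber hχ hk' hπ (by norm_num) hN hu hut hk ?_ ?_ hRu x hx _ w.1 w.1.2 w.2
      (Finset.mem_filter.1 hα0).2.1 ?_
    · rw [hR, hL]; exact le_of_eq (by ring)
    · rw [hR]
      exact Nat.mul_pos (pow_pos (by omega) _) (pow_pos (pow_pos hπ0 _) _)
    · intro α hα
      have := Finset.mem_filter.1 hα
      exact ⟨(h𝒜 α this.1).1, (h𝒜 α this.1).2.1, this.2.2⟩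
  have hcard : 𝒜.card * (π ^ 20) ^ (k * k * L) ≤ ((π ^ 20) ^ L * π ^ (k * L)) * K := by
    have h1 : 𝒜 ⊆ (Finset.univ : Finset Dt).biUnion (fun w => 𝒜.filter (fun α => Good α w)) := by
      intro α hα
      obtain ⟨w, hw⟩ := hex α hα
      exact Finset.mem_biUnion.2 ⟨w, Finset.mem_univ _, Finset.mem_filter.2 ⟨hα, hw⟩⟩
    have h2 := (Finset.card_le_card h1).trans Finset.card_biUnion_le
    calc 𝒜.card * (π ^ 20) ^ (k * k * L) ≤
          (∑ w : Dt, (𝒜.filter (fun α => Good α w)).card) * (π ^ 20) ^ (k * k * L) :=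
            Nat.mul_le_mul_right _ h2
      _ = ∑ w : Dt, (𝒜.filter (fun α => Good α w)).card * (π ^ 20) ^ (k * k * L) := by
            rw [Finset.sum_mul]
      _ ≤ ∑ w : Dt, K := Finset.sum_le_sum fun w _ => hfib w
      _ = _ := by
            rw [Finset.sum_const, Finset.card_univ, smul_eq_mul]
            congr 1
            simp only [Dt, Fintype.card_prod, Fintype.card_fin, Fintype.card_pi, Finset.prod_const,
              Finset.card_univ, Fintype.card_fun]
            rw [← pow_mul π k L]
  have hT2 : T * 2 = k * (k - 1) := Finset.sum_range_id_mul_two k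
  have hk3' : (3:ℕ) ^ k' ≤ π ^ k' := Nat.pow_le_pow_left h3 _
  have hRT : R ^ T ≤ π ^ T * (π ^ 20) ^ ((L + k) * T) := by
    rw [hR, mul_pow, ← pow_mul (π ^ 20)]
    exact Nat.mul_le_mul_right _ (Nat.pow_le_pow_left hkπ _)
  have hfin : 𝒜.card * π ^ (20 * (k * k * L)) ≤
      2 ^ u * π ^ (20 * L + k * L + 3 * k * L + 20 * (L * T) + k' + T + 20 * ((L + k) * T)) := by
    calc 𝒜.card * π ^ (20 * (k * k * L)) = 𝒜.card * (π ^ 20) ^ (k * k * L) := by rw [← pow_mul]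
      _ ≤ _ := hcard
      _ ≤ ((π ^ 20) ^ L * π ^ (k * L)) * (2 ^ u * π ^ (3 * k * L) * (π ^ 20) ^ (L * T) * π ^ k' *
            (π ^ T * (π ^ 20) ^ ((L + k) * T))) := by
          rw [hK]
          gcongr
      _ = _ := by
          simp only [← pow_mul, pow_add]; ring
  have hexp : 20 * L + k * L + 3 * k * L + 20 * (L * T) + k' + T + 20 * ((L + k) * T) + 1 ≤ 20 * (k * k * L) := by
    have e1 : k - 1 = k' := by omega
    rw [e1] at hT2
    have e2 : L = (k' + 1) ^ 2 := by rw [hL, hk']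
    rw [e2, hk']
    rw [hk'] at hT2
    have h2 : 2 ≤ k' := by omega
    obtain ⟨j, rfl⟩ : ∃ j, k' = j + 2 := ⟨k' - 2, by omega⟩
    zify at hT2 ⊢
    have hTe : (T : ℤ) * 2 = ((j:ℤ) + 2 + 1) * (j + 2) := hT2
    set τ : ℤ := (T : ℤ)
    have hj : (0:ℤ) ≤ j := by positivity
    have h5 : 0 ≤ (j:ℤ)^2 := by positivity
    have h6 : 0 ≤ (j:ℤ)^3 := by positivity
    have h7 : 0 ≤ (j:ℤ)^4 := by positivity
    push_cast
    have main : 2 * (20 * ((j:ℤ) + 2 + 1) ^ 2 + (j + 2 + 1) * (j + 2 + 1) ^ 2 + 3 * (j + 2 + 1) * (j + 2 + 1) ^ 2 + 20 * ((j + 2 + 1) ^ 2 * τ) +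
        (j + 2) + τ + 20 * (((j + 2 + 1) ^ 2 + (j + 2 + 1)) * τ) + 1) =
        40 * ((j:ℤ) + 2 + 1) ^ 2 + 8 * (j + 2 + 1) ^ 3 + 2 * (j + 2) + 2 +
        (20 * (j + 2 + 1) ^ 2 + 1 + 20 * ((j + 2 + 1) ^ 2 + (j + 2 + 1))) * (τ * 2) := by ring
    rw [hTe] at main
    nlinarith
  have hpos : 0 < π ^ (20 * L + k * L + 3 * k * L + 20 * (L * T) + k' + T + 20 * ((L + k) * T)) := pow_pos hπ0 _
  refine Nat.le_of_mul_le_mul_right ?_ hpos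
  refine le_trans ?_ hfin
  rw [mul_assoc, ← pow_succ']
  exact Nat.mul_le_mul_left _ (Nat.pow_le_pow_right hπ0 hexp)

theorem sv_shift_diff (f : ℤ → ℂ) (hf : ∀ y, ‖f y‖ ≤ 1) (X : ℤ) (H v : ℕ) :
    ‖(∑ i ∈ Finset.range H, f (X + i)) - ∑ i ∈ Finset.range H, f (X + i + v)‖ ≤ 2 * v := by
  induction v with
  | zero => simp
  | succ v ih =>
    have h1 := Finset.sum_range_succ (fun i : ℕ => f (X + i + v)) H
    have h2 := Finset.sum_range_succ' (fun i : ℕ => f (X + i + v)) H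
    have h3 : ∑ i ∈ Finset.range H, f (X + i + (v + 1 : ℕ)) = ∑ i ∈ Finset.range H, f (X + (i + 1 : ℕ) + v) :=
      Finset.sum_congr rfl fun i _ => by congr 1; push_cast; ring
    rw [h3]
    have e : (∑ i ∈ Finset.range H, f (X + i)) - ∑ i ∈ Finset.range H, f (X + (i + 1 : ℕ) + v) =
        ((∑ i ∈ Finset.range H, f (X + i)) - ∑ i ∈ Finset.range H, f (X + i + v)) +
          (f (X + (0:ℕ) + v) - f (X + H + v)) := by
      rw [h1] at h2
      linear_combination h2
    rw [e]
    refine (norm_add_le _ _).trans ?_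
    have h4 := norm_sub_le (f (X + (0:ℕ) + v)) (f (X + H + v))
    have h5 := hf (X + (0:ℕ) + v)
    have h6 := hf (X + H + v)
    push_cast at *
    linarith

theorem sv_odd_card (u : ℕ) (hu : 1 ≤ u) :
    ((Finset.range (2 ^ u)).filter Odd).card = 2 ^ (u - 1) := by
  obtain ⟨v, rfl⟩ : ∃ v, u = v + 1 := ⟨u - 1, by omega⟩
  have : (Finset.range (2 ^ (v + 1))).filter Odd = (Finset.range (2 ^ v)).image (fun i => 2 * i + 1) := by
    ext a
    simp only [Finset.mem_filter, Finset.mem_range, Finset.mem_image]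
    constructor
    · rintro ⟨h1, m, hm⟩
      refine ⟨m, ?_, hm.symm⟩
      rw [pow_succ] at h1; omega
    · rintro ⟨m, hm, rfl⟩
      refine ⟨?_, m, rfl⟩
      rw [pow_succ]; omega
  rw [this, Finset.card_image_of_injective _ (fun a b h => by simpa using h), Finset.card_range]
  rfl

theorem sv_interval {N : ℕ} {χ : ℤ → ℂ} (hχ : SvChar N χ) {t k u π : ℕ}
    (hπ : π.Prime) (h3 : 3 ≤ π) (hk3 : 3 ≤ k) (hk : Odd k) (hkπ : k ^ 3 ≤ π)
    (hN : N = t * k + u) (hu : 1 ≤ u) (hut : u ≤ t)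
    (hRu : (k ^ 3 * (π ^ 20) ^ (k ^ 2 + k)) ^ k < 2 ^ (u - 1)) (X : ℤ) (H : ℕ) :
    ‖∑ i ∈ Finset.range H, χ (X + i)‖ ≤
      2 * (k + 1) / (π : ℝ) * H + 2 ^ (t + u + 1) * (((π ^ 20) ^ (k ^ 2 + k) : ℕ) : ℝ) := by
  classical
  have hπ0 : 0 < π := hπ.pos
  have hπR : (0 : ℝ) < π := by exact_mod_cast hπ0
  set A := (π ^ 20) ^ (k ^ 2 + k) with hA
  have hA0 : 0 < A := pow_pos (pow_pos hπ0 _) _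
  have hAR : (0 : ℝ) < A := by exact_mod_cast hA0
  have hnorm : ∀ y, ‖χ y‖ ≤ 1 := by
    intro y
    rcases Int.even_or_odd y with h | h
    · rw [hχ.even_zero y h]; simp
    · exact (hχ.norm_odd y h).le
  set O := (Finset.range (2 ^ u)).filter Odd with hO
  have hOc : (O.card : ℝ) = 2 ^ (u - 1) := by rw [hO, sv_odd_card u hu]; norm_cast
  have hO2 : (2:ℝ) ^ u = 2 * O.card := by rw [hOc, ← pow_succ']; congr 1; omega
  have hOpos : (0:ℝ) < O.card := by rw [hOc]; positivity
  set S := ∑ i ∈ Finset.range H, χ (X + i) with hS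
  have hpt : ∀ x : ℤ, ∑ α ∈ O, ‖∑ b ∈ Finset.range A, χ (x + 2 ^ t * α * (b : ℤ))‖ ≤
      O.card * A * (2 * (k + 1) / (π : ℝ)) := by
    intro x
    rcases Int.even_or_odd x with hx | hx
    · have : ∀ α ∈ O, ‖∑ b ∈ Finset.range A, χ (x + 2 ^ t * α * (b : ℤ))‖ = 0 := by
        intro α _
        rw [norm_eq_zero]
        refine Finset.sum_eq_zero fun b _ => hχ.even_zero _ (hx.add ?_)
        rw [mul_assoc]
        exact Even.mul_right (Even.pow_of_ne_zero even_two (by omega)) _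
      rw [Finset.sum_eq_zero this]
      positivity
    · set bad := O.filter (fun α : ℕ => (2 * k / (π : ℝ)) * (A : ℝ) ≤
        ‖∑ b ∈ Finset.range A, χ (x + 2 ^ t * α * (b : ℤ))‖) with hbad
      have hb : bad.card * π ≤ 2 ^ u := by
        refine sv_dense hχ hπ h3 hk3 hk hkπ hN hu hut hRu x hx bad ?_
        intro α hα
        have h1 := Finset.mem_filter.1 hα
        have h2 := Finset.mem_filter.1 h1.1
        exact ⟨Finset.mem_range.1 h2.1, h2.2, h1.2⟩
      have hb' : (bad.card : ℝ) * π ≤ 2 * O.card := by rw [← hO2]; exact_mod_cast hb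
      have hb2 : (bad.card : ℝ) ≤ 2 * O.card / π := by rwa [le_div_iff₀ hπR]
      calc ∑ α ∈ O, ‖∑ b ∈ Finset.range A, χ (x + 2 ^ t * α * (b : ℤ))‖ ≤
            ∑ α ∈ O, ((if (2 * k / (π : ℝ)) * (A : ℝ) ≤
              ‖∑ b ∈ Finset.range A, χ (x + 2 ^ t * α * (b : ℤ))‖ then (A : ℝ) else 0) + (2 * k / (π : ℝ)) * (A : ℝ)) := by
            refine Finset.sum_le_sum fun α _ => ?_
            split_ifs with h
            · have : ‖∑ b ∈ Finset.range A, χ (x + 2 ^ t * α * (b : ℤ))‖ ≤ ∑ b ∈ Finset.range A, (1:ℝ) :=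
                (norm_sum_le _ _).trans (Finset.sum_le_sum fun y _ => hnorm _)
              simp only [Finset.sum_const, Finset.card_range, nsmul_eq_mul, mul_one] at this
              have h2 : 0 ≤ (2 * k / (π : ℝ)) * (A : ℝ) := by positivity
              linarith
            · rw [zero_add]; exact (not_le.1 h).le
        _ = bad.card * A + O.card * ((2 * k / (π : ℝ)) * (A : ℝ)) := by
            rw [Finset.sum_add_distrib, ← Finset.sum_filter, Finset.sum_const, Finset.sum_const,
              nsmul_eq_mul, nsmul_eq_mul]
        _ ≤ 2 * O.card / π * A + O.card * ((2 * k / (π : ℝ)) * (A : ℝ)) := by gcongr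
        _ = _ := by field_simp; ring
  have hsh : ∀ α ∈ O, ∀ b ∈ Finset.range A, ‖S - ∑ i ∈ Finset.range H, χ (X + i + 2 ^ t * α * (b : ℤ))‖ ≤
      2 ^ (t + u + 1) * (A : ℝ) := by
    intro α hα b hb
    have h1 := sv_shift_diff χ hnorm X H (2 ^ t * α * b)
    push_cast at h1
    refine h1.trans ?_
    have h2 : (α : ℝ) ≤ 2 ^ u := by
      have := Finset.mem_range.1 (Finset.mem_filter.1 hα).1
      exact_mod_cast this.le
    have h3 : (b : ℝ) ≤ A := by exact_mod_cast (Finset.mem_range.1 hb).le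
    calc 2 * (2 ^ t * (α : ℝ) * b) ≤ 2 * (2 ^ t * 2 ^ u * A) := by gcongr
      _ = _ := by ring
  set V : ℝ := 2 ^ (t + u + 1) * (A : ℝ) with hV
  have hmain : (O.card : ℝ) * A * ‖S‖ ≤ O.card * A * (2 * (k + 1) / (π : ℝ) * H + V) := by
    have e1 : ((O.card : ℂ) * A) * S = ∑ α ∈ O, ∑ b ∈ Finset.range A,
          (S - ∑ i ∈ Finset.range H, χ (X + i + 2 ^ t * α * (b : ℤ))) +
        ∑ i ∈ Finset.range H, ∑ α ∈ O, ∑ b ∈ Finset.range A, χ (X + i + 2 ^ t * α * (b : ℤ)) := by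
      have e2 : ∑ i ∈ Finset.range H, ∑ α ∈ O, ∑ b ∈ Finset.range A, χ (X + i + 2 ^ t * α * (b : ℤ)) =
          ∑ α ∈ O, ∑ b ∈ Finset.range A, ∑ i ∈ Finset.range H, χ (X + i + 2 ^ t * α * (b : ℤ)) := by
        rw [Finset.sum_comm]
        exact Finset.sum_congr rfl fun α _ => Finset.sum_comm
      rw [e2, ← Finset.sum_add_distrib]
      simp only [← Finset.sum_add_distrib, sub_add_cancel, Finset.sum_const, Finset.card_range, nsmul_eq_mul]
      ring
    have e3 : (O.card : ℝ) * A * ‖S‖ = ‖((O.card : ℂ) * A) * S‖ := by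
      rw [norm_mul, norm_mul, Complex.norm_natCast, Complex.norm_natCast]
    rw [e3, e1]
    refine (norm_add_le _ _).trans ?_
    have h1 : ‖∑ α ∈ O, ∑ b ∈ Finset.range A,
          (S - ∑ i ∈ Finset.range H, χ (X + i + 2 ^ t * α * (b : ℤ)))‖ ≤ O.card * A * V := by
      calc _ ≤ ∑ α ∈ O, ∑ b ∈ Finset.range A, V := by
            refine (norm_sum_le _ _).trans (Finset.sum_le_sum fun α hα => ?_)
            exact (norm_sum_le _ _).trans (Finset.sum_le_sum fun b hb => hsh α hα b hb)
        _ = _ := by simp only [Finset.sum_const, Finset.card_range, nsmul_eq_mul]; ring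
    have h2 : ‖∑ i ∈ Finset.range H, ∑ α ∈ O, ∑ b ∈ Finset.range A, χ (X + i + 2 ^ t * α * (b : ℤ))‖ ≤
        O.card * A * (2 * (k + 1) / (π : ℝ) * H) := by
      calc _ ≤ ∑ i ∈ Finset.range H, O.card * A * (2 * (k + 1) / (π : ℝ)) := by
            refine (norm_sum_le _ _).trans (Finset.sum_le_sum fun i _ => ?_)
            exact (norm_sum_le _ _).trans (hpt (X + i))
        _ = _ := by simp only [Finset.sum_const, Finset.card_range, nsmul_eq_mul]; ring
    linarith
  exact le_of_mul_le_mul_left hmain (by positivity)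

theorem sv_params {n h N b T : ℕ} (hT : T = h / 8) (hN1 : h < N) (hN2 : N ≤ n) (hb : 1 ≤ b)
    (hbig : 1600 * b * n ^ 3 ≤ T ^ 4) : ∃ k t u : ℕ, Odd k ∧ 3 ≤ k ∧ k + 1 ≤ n ∧
      N = t * k + u ∧ 1 ≤ u ∧ u ≤ t ∧ 108 * b * k ^ 3 + 2 ≤ u ∧
      t + u + 1 + 108 * b * k ^ 2 + 2 * b ≤ h := by
  have hn : 1 ≤ n := by omega
  have hT0 : 1 ≤ T := by
    rcases Nat.eq_zero_or_pos T with h0 | h0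
    · rw [h0] at hbig
      have : 0 < 1600 * b * n ^ 3 := by positivity
      simp at hbig; omega
    · exact h0
  have h8 : 8 * T ≤ h := by omega
  obtain ⟨c, hc1, hc2⟩ : ∃ c, N ≤ 2 * T * c ∧ 2 * T * c ≤ N + 2 * T - 1 := by
    refine ⟨(N + 2 * T - 1) / (2 * T), ?_, Nat.mul_div_le _ _⟩
    have := Nat.lt_mul_div_succ (N + 2 * T - 1) (show 0 < 2 * T by omega)
    rw [mul_add] at this
    omega
  have hc5 : 5 ≤ c := by
    by_contra hlt
    have : c ≤ 4 := by omega
    have : 2 * T * c ≤ 2 * T * 4 := Nat.mul_le_mul_left _ this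
    omega
  obtain ⟨t, ht1, ht2⟩ : ∃ t, N ≤ 2 * c * t ∧ 2 * c * t ≤ N + 2 * c - 1 := by
    refine ⟨(N + 2 * c - 1) / (2 * c), ?_, Nat.mul_div_le _ _⟩
    have := Nat.lt_mul_div_succ (N + 2 * c - 1) (show 0 < 2 * c by omega)
    rw [mul_add] at this
    omega
  obtain ⟨k, hk⟩ : ∃ k, k + 1 = 2 * c := ⟨2 * c - 1, by omega⟩
  have hk9 : 9 ≤ k := by omega
  have htT : t ≤ T := by
    by_contra hlt
    have h1 : T + 1 ≤ t := by omega
    have h2 : 2 * c * (T + 1) ≤ 2 * c * t := Nat.mul_le_mul_left _ h1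
    have h3 : 2 * c * (T + 1) = 2 * T * c + 2 * c := by ring
    omega
  have h45 : 4 * T ≤ 5 * t := by
    have h1 : 2 * c * (4 * T) ≤ 2 * c * (5 * t) := by
      have e1 : 2 * c * (4 * T) = 4 * (2 * T * c) := by ring
      have e2 : 2 * c * (5 * t) = 5 * (2 * c * t) := by ring
      omega
    exact Nat.le_of_mul_le_mul_left h1 (by omega)
  have hkT : k * T ≤ 2 * n := by
    have : (k + 1) * T = 2 * T * c := by rw [hk]; ring
    have e : (k + 1) * T = k * T + T := by ring
    omega
  have hb3 : 200 * b * k ^ 3 ≤ T := by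
    have h1 : 200 * b * k ^ 3 * T ^ 3 ≤ T * T ^ 3 := by
      calc 200 * b * k ^ 3 * T ^ 3 = 200 * b * (k * T) ^ 3 := by ring
        _ ≤ 200 * b * (2 * n) ^ 3 := by gcongr
        _ = 1600 * b * n ^ 3 := by ring
        _ ≤ T ^ 4 := hbig
        _ = _ := by ring
    exact Nat.le_of_mul_le_mul_right h1 (by positivity)
  have hkk : k ≤ b * k ^ 3 := by
    calc k = 1 * k ^ 1 := by ring
      _ ≤ b * k ^ 3 := Nat.mul_le_mul hb (Nat.pow_le_pow_right (by omega) (by omega))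
  have hkb : b ≤ b * k ^ 3 := Nat.le_mul_of_pos_right _ (by positivity)
  have hk23 : b * k ^ 2 ≤ b * k ^ 3 := Nat.mul_le_mul_left _ (Nat.pow_le_pow_right (by omega) (by omega))
  have a1 : 200 * b * k ^ 3 = 200 * (b * k ^ 3) := by ring
  have a2 : 108 * b * k ^ 3 = 108 * (b * k ^ 3) := by ring
  have a3 : 108 * b * k ^ 2 = 108 * (b * k ^ 2) := by ring
  rw [← hk] at ht1 ht2
  have a4 : (k + 1) * t = t * k + t := by ring
  rw [a1] at hb3
  generalize b * k ^ 3 = Z at *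
  generalize b * k ^ 2 = Z2 at *
  refine ⟨k, t, N - t * k, ⟨c - 1, by omega⟩, by omega, by omega, by omega, by omega, by omega, by omega, by omega⟩

theorem sv_pow_bound {b k π : ℕ} (hπ : π ≤ 2 ^ (4 * b)) (hk : 3 ≤ k) :
    (π ^ 20) ^ (k ^ 2 + k) ≤ 2 ^ (107 * b * k ^ 2) := by
  calc (π ^ 20) ^ (k ^ 2 + k) ≤ ((2 ^ (4 * b)) ^ 20) ^ (k ^ 2 + k) := by gcongr
    _ = 2 ^ (80 * b * (k ^ 2 + k)) := by rw [← pow_mul, ← pow_mul]; congr 1; ring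
    _ ≤ _ := by
      refine Nat.pow_le_pow_right (by norm_num) ?_
      have : 80 * (k ^ 2 + k) ≤ 107 * k ^ 2 := by nlinarith
      nlinarith

theorem sv_bound {n h N b : ℕ} (hN1 : h < N) (hN2 : N ≤ n) (hb : 1 ≤ b) (hnb : n ≤ 2 ^ b)
    (hbig : 1600 * b * n ^ 3 ≤ (h / 8) ^ 4) {χ : ℤ → ℂ} (hχ : SvChar N χ) (X : ℤ) :
    ‖∑ i ∈ Finset.range (2 ^ h), χ (X + i)‖ ≤ 3 * 2 ^ h / (n : ℝ) ^ 2 := by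
  obtain ⟨k, t, u, hk, hk3, hkn, hN, hu, hut, hu2, hh⟩ := sv_params rfl hN1 hN2 hb hbig
  have hn0 : 0 < n := by omega
  obtain ⟨π, hπ, hπ1, hπ2⟩ := Nat.exists_prime_lt_and_le_two_mul (n ^ 3) (by positivity)
  have hπ4 : π ≤ 2 ^ (4 * b) := by
    calc π ≤ 2 * n ^ 3 := hπ2
      _ ≤ 2 * (2 ^ b) ^ 3 := by gcongr
      _ = 2 ^ (1 + 3 * b) := by rw [pow_add, ← pow_mul]; ring_nf
      _ ≤ _ := Nat.pow_le_pow_right (by norm_num) (by omega)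
  have hA := sv_pow_bound hπ4 hk3
  have hkπ : k ^ 3 ≤ π := by
    calc k ^ 3 ≤ n ^ 3 := Nat.pow_le_pow_left (by omega) _
      _ ≤ π := hπ1.le
  have hn3 : n ≤ n ^ 3 := Nat.le_self_pow (by norm_num) n
  have hRu : (k ^ 3 * (π ^ 20) ^ (k ^ 2 + k)) ^ k < 2 ^ (u - 1) := by
    calc (k ^ 3 * (π ^ 20) ^ (k ^ 2 + k)) ^ k ≤ (2 ^ (4 * b) * 2 ^ (107 * b * k ^ 2)) ^ k :=
          Nat.pow_le_pow_left (Nat.mul_le_mul (hkπ.trans hπ4) hA) _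
      _ = 2 ^ ((4 * b + 107 * b * k ^ 2) * k) := by rw [← pow_add, ← pow_mul]
      _ ≤ 2 ^ (108 * b * k ^ 3) := by
          refine Nat.pow_le_pow_right (by norm_num) ?_
          have h1 : 4 ≤ k ^ 2 := by nlinarith
          calc (4 * b + 107 * b * k ^ 2) * k ≤ (k ^ 2 * b + 107 * b * k ^ 2) * k := by gcongr
            _ = _ := by ring
      _ < _ := Nat.pow_lt_pow_right (by norm_num) (by omega)
  have key := sv_interval hχ hπ (by omega) hk3 hk hkπ hN hu hut hRu X (2 ^ h)
  refine key.trans ?_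
  have hnR : (0:ℝ) < n := by exact_mod_cast hn0
  have h1 : 2 * ((k:ℝ) + 1) / (π : ℝ) * ((2 ^ h : ℕ) : ℝ) ≤ 2 * 2 ^ h / (n : ℝ) ^ 2 := by
    have hk' : (k : ℝ) + 1 ≤ n := by exact_mod_cast hkn
    have hπ' : (n : ℝ) ^ 3 ≤ π := by exact_mod_cast hπ1.le
    push_cast
    calc 2 * ((k:ℝ) + 1) / (π : ℝ) * 2 ^ h ≤ 2 * n / (n : ℝ) ^ 3 * 2 ^ h := by gcongr
      _ = _ := by field_simp
  have h2 : (2:ℝ) ^ (t + u + 1) * (((π ^ 20) ^ (k ^ 2 + k) : ℕ) : ℝ) ≤ 2 ^ h / (n : ℝ) ^ 2 := by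
    rw [le_div_iff₀ (by positivity)]
    have h3 : 2 ^ (t + u + 1) * (π ^ 20) ^ (k ^ 2 + k) * n ^ 2 ≤ 2 ^ h := by
      calc 2 ^ (t + u + 1) * (π ^ 20) ^ (k ^ 2 + k) * n ^ 2 ≤
            2 ^ (t + u + 1) * 2 ^ (107 * b * k ^ 2) * (2 ^ b) ^ 2 := by gcongr
        _ = 2 ^ (t + u + 1 + 107 * b * k ^ 2 + 2 * b) := by
            rw [← pow_mul, ← pow_add, ← pow_add]; congr 1; ring
        _ ≤ _ := by
            refine Nat.pow_le_pow_right (by norm_num) (le_trans ?_ hh)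
            have : 107 * b * k ^ 2 ≤ 108 * b * k ^ 2 := by gcongr; norm_num
            omega
    exact_mod_cast h3
  calc _ ≤ 2 * 2 ^ h / (n : ℝ) ^ 2 + 2 ^ h / (n : ℝ) ^ 2 := add_le_add h1 h2
    _ = _ := by ring

/-- Short conductor: the sum over a full interval vanishes. -/
theorem sv_zero {h N : ℕ} (hN0 : 2 ≤ N) (hN1 : N ≤ h) {χ : ℤ → ℂ} (hχ : SvChar N χ) (X : ℤ) :
    ∑ i ∈ Finset.range (2 ^ h), χ (X + i) = 0 := by
  have hper : ∀ x : ℤ, χ (x + (2 ^ h : ℕ)) = χ x := by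
    intro x
    apply hχ.per
    rw [add_sub_cancel_left]; push_cast
    exact pow_dvd_pow _ hN1
  have h1 := sv_shift_sum χ (2 ^ h) hper X (2 ^ (N - 1))
  have h2 : ∀ i : ℕ, χ (X + (2 ^ (N - 1) : ℕ) + i) = - χ (X + i) := by
    intro i
    rcases Int.even_or_odd (X + i) with he | ho
    · rw [hχ.even_zero _ he, hχ.even_zero, neg_zero]
      have : Even ((2 ^ (N - 1) : ℕ) : ℤ) := by
        push_cast; exact Even.pow_of_ne_zero even_two (by omega)
      have := he.add this
      rwa [show X + (2 ^ (N - 1) : ℕ) + i = X + i + (2 ^ (N - 1) : ℕ) by ring]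
    · rw [← mul_neg_one, ← hχ.neg, ← hχ.mul]
      apply hχ.per
      obtain ⟨m, hm⟩ := ho
      rw [hm]
      refine ⟨-m, ?_⟩
      have : (2:ℤ) ^ N = 2 * 2 ^ (N - 1) := by rw [← pow_succ']; congr 1; omega
      rw [this]
      push_cast
      linear_combination hm
  simp only [h2] at h1
  rw [Finset.sum_neg_distrib] at h1
  exact self_eq_neg.1 h1.symm

theorem sv_size : ∃ n₀ : ℕ, 1 ≤ n₀ ∧ ∀ n : ℕ, n₀ ≤ n → ∀ m : ℕ,
    m = ⌊(n : ℝ) - (n : ℝ) ^ ((3 : ℝ)/4) * Real.log n⌋₊ →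
    m < n ∧ (n - m < n → ∃ b : ℕ, 1 ≤ b ∧ n ≤ 2 ^ b ∧ 1600 * b * n ^ 3 ≤ ((n - m) / 8) ^ 4) := by
  refine ⟨⌈Real.exp 1000⌉₊ + 1, by omega, ?_⟩
  intro n hn m hm
  have hn0 : 1 ≤ n := by omega
  have hnR : (0:ℝ) < n := by exact_mod_cast hn0
  have hn1 : (1:ℝ) ≤ n := by exact_mod_cast hn0
  have hexp : Real.exp 1000 ≤ n := by
    have h1 := Nat.le_ceil (Real.exp 1000)
    have h2 : ((⌈Real.exp 1000⌉₊ : ℕ) : ℝ) ≤ n := by exact_mod_cast (by omega)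
    linarith
  set l := Real.log n with hl
  have hl1 : 1000 ≤ l := (Real.le_log_iff_exp_le hnR).2 hexp
  set r := (n : ℝ) ^ ((3 : ℝ)/4) with hr
  have hr1 : 1 ≤ r := Real.one_le_rpow hn1 (by norm_num)
  have hr4 : r ^ 4 = (n : ℝ) ^ 3 := by
    rw [hr, ← Real.rpow_natCast, ← Real.rpow_mul hnR.le, ← Real.rpow_natCast]
    norm_num
  have hy : 1000 ≤ r * l := by nlinarith
  rcases Nat.eq_zero_or_pos m with h0 | h0
  · refine ⟨by omega, fun h => by omega⟩
  have hpos : 0 ≤ (n : ℝ) - r * l := by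
    by_contra hlt
    push Not at hlt
    rw [hm, Nat.floor_of_nonpos hlt.le] at h0
    omega
  have hfl : (m : ℝ) ≤ (n : ℝ) - r * l := by rw [hm]; exact Nat.floor_le hpos
  have hmn : m < n := by
    have : (m : ℝ) < n := by linarith
    exact_mod_cast this
  refine ⟨hmn, fun _ => ?_⟩
  set h := n - m with hh
  have hhR : r * l ≤ (h : ℝ) := by
    rw [hh, Nat.cast_sub hmn.le]; linarith
  refine ⟨⌈2 * l⌉₊, ?_, ?_, ?_⟩
  · exact Nat.one_le_iff_ne_zero.2 (Nat.ceil_pos.2 (by linarith)).ne'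
  · have h2 := Nat.le_ceil (2 * l)
    generalize ⌈2 * l⌉₊ = b at h2 ⊢
    have h1 : (n : ℝ) ≤ 2 ^ b := by
      rw [← Real.exp_log hnR, ← Real.exp_log (show (0:ℝ) < 2 by norm_num), ← Real.exp_nat_mul]
      apply Real.exp_le_exp.2
      have h3 := Real.log_two_gt_d9
      rw [← hl]
      nlinarith
    exact_mod_cast h1
  · have hb : ((⌈2 * l⌉₊ : ℕ) : ℝ) ≤ 3 * l := by
      have := Nat.ceil_lt_add_one (show 0 ≤ 2 * l by linarith)
      linarith
    have h8 : r * l / 16 ≤ ((h / 8 : ℕ) : ℝ) := by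
      have h1 : h < 8 * (h / 8) + 8 := by omega
      have h2 : (h : ℝ) < 8 * ((h / 8 : ℕ) : ℝ) + 8 := by exact_mod_cast h1
      linarith
    have h9 : (r * l / 16) ^ 4 ≤ ((h / 8 : ℕ) : ℝ) ^ 4 := pow_le_pow_left₀ (by linarith) h8 4
    have h10 : (1600 : ℝ) * ((⌈2 * l⌉₊ : ℕ) : ℝ) * (n : ℝ) ^ 3 ≤ (r * l / 16) ^ 4 := by
      calc (1600 : ℝ) * ((⌈2 * l⌉₊ : ℕ) : ℝ) * (n : ℝ) ^ 3 ≤ 1600 * (3 * l) * (n : ℝ) ^ 3 := by gcongr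
        _ = (n : ℝ) ^ 3 * (4800 * l) := by ring
        _ ≤ (n : ℝ) ^ 3 * (l ^ 4 / 65536) := by
            gcongr
            have : (1000:ℝ) ^ 3 ≤ l ^ 3 := by gcongr
            nlinarith
        _ = _ := by rw [← hr4]; ring
    exact_mod_cast h10.trans h9

theorem sv_unit_iff {n : ℕ} (hn : 1 ≤ n) (x : ℤ) : IsUnit (x : ZMod (2 ^ n)) ↔ Odd x := by
  constructor
  · intro h
    by_contra ho
    rw [Int.not_odd_iff_even] at ho
    have h2 := h.map (ZMod.castHom (dvd_pow_self 2 (by omega) : 2 ∣ 2 ^ n) (ZMod 2))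
    rw [map_intCast] at h2
    rw [(ZMod.intCast_zmod_eq_zero_iff_dvd x 2).2 (by exact_mod_cast ho.two_dvd)] at h2
    exact not_isUnit_zero h2
  · intro h
    obtain ⟨v, hv⟩ := sv_inv (N := n) h
    refine IsUnit.of_mul_eq_one (v : ZMod (2 ^ n)) ?_
    have : ((x * v - 1 : ℤ) : ZMod (2 ^ n)) = 0 :=
      (ZMod.intCast_zmod_eq_zero_iff_dvd _ _).2 (by exact_mod_cast hv)
    push_cast at this
    exact sub_eq_zero.1 this

theorem sv_char_exists {n : ℕ} (hn : 1 ≤ n) (χ : DirichletCharacter ℂ (2 ^ n)) (hχ : χ ≠ 1) :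
    ∃ N, 2 ≤ N ∧ N ≤ n ∧ SvChar N (fun x : ℤ => χ (x : ZMod (2 ^ n))) := by
  classical
  set f : ℤ → ℂ := fun x : ℤ => χ (x : ZMod (2 ^ n)) with hf
  have hmul : ∀ x y, f (x * y) = f x * f y := by
    intro x y; simp only [hf]; push_cast; exact map_mul _ _ _
  have hone : f 1 = 1 := by simp [hf]
  have heven : ∀ x, Even x → f x = 0 := by
    intro x hx
    refine χ.map_nonunit ?_
    rw [sv_unit_iff hn]
    exact Int.not_odd_iff_even.2 hx
  have hnorm : ∀ x, Odd x → ‖f x‖ = 1 := by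
    intro x hx
    obtain ⟨a, ha⟩ := (sv_unit_iff hn x).2 hx
    simp only [hf]
    rw [← ha]
    exact χ.unit_norm_eq_one a
  have hpern : ∀ x y, (2 ^ n : ℤ) ∣ x - y → f x = f y := by
    intro x y h
    simp only [hf]
    congr 1
    have : ((x - y : ℤ) : ZMod (2 ^ n)) = 0 :=
      (ZMod.intCast_zmod_eq_zero_iff_dvd _ _).2 (by exact_mod_cast h)
    push_cast at this
    exact sub_eq_zero.1 this
  let Pd : ℕ → Prop := fun N => ∀ w : ℤ, (2 ^ N : ℤ) ∣ w - 1 → f w = 1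
  have hPn : Pd n := fun w hw => (hpern w 1 hw).trans hone
  have hex : ∃ N, Pd N := ⟨n, hPn⟩
  set N := Nat.find hex with hN
  have hPN : Pd N := Nat.find_spec hex
  have hNn : N ≤ n := Nat.find_min' hex hPn
  have h0 : ¬ Pd 0 := by
    intro h
    have := h 0 (by simp)
    rw [heven 0 (by simp)] at this
    exact zero_ne_one this
  have h1 : ¬ Pd 1 := by
    intro h
    apply hχ
    ext a
    have ha : IsUnit (a : ZMod (2 ^ n)) := a.isUnit
    obtain ⟨w, hw⟩ := ZMod.intCast_surjective (a : ZMod (2 ^ n))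
    rw [← hw] at ha
    have ho := (sv_unit_iff hn w).1 ha
    have h2 := h w (by rw [pow_one]; obtain ⟨m, hm⟩ := ho; exact ⟨m, by rw [hm]; ring⟩)
    rw [MulChar.one_apply_coe, ← hw]
    exact h2
  have hN2 : 2 ≤ N := by
    by_contra hlt
    have : N = 0 ∨ N = 1 := by omega
    rcases this with h | h
    · rw [h] at hPN; exact h0 hPN
    · rw [h] at hPN; exact h1 hPN
  have hper : ∀ x y, (2 ^ N : ℤ) ∣ x - y → f x = f y := by
    intro x y h
    have h2 : (2 : ℤ) ∣ x - y := (dvd_pow_self 2 (by omega)).trans h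
    rcases Int.even_or_odd x with hx | hx
    · have hy : Even y := by
        have := hx.sub (even_iff_two_dvd.2 h2)
        rwa [sub_sub_cancel] at this
      rw [heven x hx, heven y hy]
    · obtain ⟨v, hv⟩ := sv_inv (N := n) hx
      have e1 : f (x * v) = 1 := hPn _ hv
      have e2 : f (y * v) = 1 := by
        apply hPN
        have h3 := dvd_sub ((pow_dvd_pow 2 hNn).trans hv) (h.mul_right v)
        rwa [show x * v - 1 - (x - y) * v = y * v - 1 by ring] at h3
      rw [hmul] at e1 e2
      have hv0 : f v ≠ 0 := by
        intro h; rw [h, mul_zero] at e1; exact zero_ne_one e1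
      exact mul_right_cancel₀ hv0 (e1.trans e2.symm)
  have hpow : (2:ℤ) ^ N = 2 * 2 ^ (N - 1) := by rw [← pow_succ']; congr 1; omega
  have hneg : f (1 + 2 ^ (N - 1)) = -1 := by
    have hnot : ¬ Pd (N - 1) := Nat.find_min hex (by omega)
    simp only [Pd] at hnot
    push Not at hnot
    obtain ⟨w, ⟨e, he⟩, hw⟩ := hnot
    have hne : f (1 + 2 ^ (N - 1)) ≠ 1 := by
      rcases Int.even_or_odd e with hE | hO
      · exfalso
        apply hw
        apply hPN
        obtain ⟨m, hm⟩ := hE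
        exact ⟨m, by rw [he, hpow, hm]; ring⟩
      · obtain ⟨m, hm⟩ := hO
        rw [← hper w]
        · exact hw
        · exact ⟨m, by rw [hpow]; rw [hm] at he; linear_combination he⟩
    have hsq : f (1 + 2 ^ (N - 1)) * f (1 + 2 ^ (N - 1)) = 1 := by
      rw [← hmul]
      apply hPN
      have : (2:ℤ) ^ (N - 1) = 2 * 2 ^ (N - 2) := by rw [← pow_succ']; congr 1; omega
      exact ⟨1 + 2 ^ (N - 2), by rw [hpow, this]; ring⟩
    rcases mul_self_eq_one_iff.1 hsq with h | h
    · exact absurd h hne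
    · exact h
  exact ⟨N, hN2, hNn, ⟨hmul, hper, hnorm, heven, hone, hneg⟩⟩

theorem sv_prime_odd {n p : ℕ} (hn : 2 ≤ n) (hp : p ∈ primesP n) : Odd p ∧ p < 2 ^ n := by
  rw [primesP, Finset.mem_filter, Finset.mem_Ioo] at hp
  refine ⟨hp.2.odd_of_ne_two ?_, hp.1.2⟩
  have : 2 ^ 1 ≤ 2 ^ (n - 1) := Nat.pow_le_pow_right (by norm_num) (by omega)
  omega

theorem sv_final {n m s : ℕ} (hn : 2 ≤ n) (hm : m < n) (B : ℝ) (hBn : 0 ≤ B)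
    (hB : ∀ χ : DirichletCharacter ℂ (2 ^ n), χ ≠ 1 →
      ‖∑ k ∈ Finset.range (2 ^ (n - m)), χ (((2 ^ (n - m) * s + k : ℤ)) : ZMod (2 ^ n))‖ ≤ B) :
    |(∑ k ∈ Finset.range (2 ^ (n - m)), (countN n m s (k : ℤ) : ℝ)) -
      ((primesP n).card : ℝ) ^ 2 / 2 ^ m| ≤ B * (primesP n).card := by
  classical
  set q := 2 ^ n with hq
  have : NeZero q := ⟨by positivity⟩
  set P := primesP n with hP
  set H := 2 ^ (n - m) with hH
  have hunit : ∀ p ∈ P, IsUnit ((p : ℕ) : ZMod q) := by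
    intro p hp
    have := (sv_unit_iff (n := n) (by omega) (p : ℤ)).2 (by exact_mod_cast (sv_prime_odd hn hp).1)
    simpa using this
  have hφ : (q.totient : ℝ) = 2 ^ (n - 1) := by
    rw [hq, Nat.totient_prime_pow Nat.prime_two (by omega)]; simp
  have hφ0 : (0:ℝ) < q.totient := by rw [hφ]; positivity
  have hinv : ∀ (χ : DirichletCharacter ℂ q) (a : ZMod q), IsUnit a → χ a⁻¹ = (χ a)⁻¹ := by
    intro χ a ha
    have h1 : χ a⁻¹ * χ a = 1 := by
      rw [← map_mul, ZMod.inv_mul_of_unit _ ha, map_one]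
    exact eq_inv_of_mul_eq_one_left h1
  set S : DirichletCharacter ℂ q → ℂ := fun χ => ∑ p ∈ P, (χ ((p : ℕ) : ZMod q))⁻¹ with hS
  set Xs : DirichletCharacter ℂ q → ℂ := fun χ =>
    ∑ k ∈ Finset.range H, χ (((2 ^ (n - m) * s + k : ℤ)) : ZMod q) with hX
  have hcount : ∀ k : ℕ, (q.totient : ℂ) * (countN n m s (k : ℤ) : ℂ) =
      ∑ χ : DirichletCharacter ℂ q, S χ ^ 2 * χ (((2 ^ (n - m) * s + k : ℤ)) : ZMod q) := by
    intro k
    set y : ZMod q := (((2 ^ (n - m) * s + k : ℤ)) : ZMod q) with hy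
    have e1 : (countN n m s (k : ℤ) : ℂ) = ∑ p ∈ P, ∑ l ∈ P,
        if ((p : ℕ) : ZMod q) * ((l : ℕ) : ZMod q) = y then (1:ℂ) else 0 := by
      rw [countN, Finset.card_filter, ← Finset.sum_product']
      push_cast
      refine Finset.sum_congr rfl fun w _ => ?_
      congr 1
      rw [eq_iff_iff, hy]
      have := ZMod.intCast_eq_intCast_iff (w.1 * w.2 : ℤ) (2 ^ (n - m) * s + k : ℤ) q
      rw [hq] at this ⊢
      push_cast at this ⊢
      exact this.symm
    rw [e1, Finset.mul_sum]
    simp only [Finset.mul_sum]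
    have e2 : ∀ p ∈ P, ∀ l ∈ P, (q.totient : ℂ) * (if ((p : ℕ) : ZMod q) * ((l : ℕ) : ZMod q) = y then (1:ℂ) else 0) =
        ∑ χ : DirichletCharacter ℂ q, (χ ((p : ℕ) : ZMod q))⁻¹ * (χ ((l : ℕ) : ZMod q))⁻¹ * χ y := by
      intro p hp l hl
      have hu := (hunit p hp).mul (hunit l hl)
      have h1 := DirichletCharacter.sum_char_inv_mul_char_eq ℂ hu y
      rw [mul_ite, mul_one, mul_zero, ← h1]
      refine Finset.sum_congr rfl fun χ _ => ?_
      rw [hinv χ _ hu, map_mul, mul_inv]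
    rw [Finset.sum_congr rfl fun p hp => Finset.sum_congr rfl fun l hl => e2 p hp l hl]
    rw [Finset.sum_congr rfl fun p _ => Finset.sum_comm, Finset.sum_comm]
    refine Finset.sum_congr rfl fun χ _ => ?_
    simp only [hS]
    rw [sq, Finset.sum_mul_sum, Finset.sum_mul]
    exact Finset.sum_congr rfl fun p _ => by rw [Finset.sum_mul]
  set Tot : ℝ := ∑ k ∈ Finset.range H, (countN n m s (k : ℤ) : ℝ) with hTot
  have htot : (q.totient : ℂ) * (Tot : ℂ) = ∑ χ : DirichletCharacter ℂ q, S χ ^ 2 * Xs χ := by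
    rw [hTot]
    push_cast
    rw [Finset.mul_sum]
    simp only [hcount, hX, Finset.mul_sum]
    rw [Finset.sum_comm]
  have hpar : ∑ χ : DirichletCharacter ℂ q, ‖S χ‖ ^ 2 = q.totient * P.card := by
    have h1 : ((∑ χ : DirichletCharacter ℂ q, ‖S χ‖ ^ 2 : ℝ) : ℂ) = ((q.totient * P.card : ℝ) : ℂ) := by
      push_cast
      have e3 : ∀ χ : DirichletCharacter ℂ q, ((‖S χ‖ : ℂ)) ^ 2 =
          ∑ p ∈ P, ∑ l ∈ P, χ ((p : ℕ) : ZMod q)⁻¹ * χ ((l : ℕ) : ZMod q) := by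
        intro χ
        rw [← Complex.mul_conj', hS]
        simp only [map_sum]
        rw [Finset.sum_mul_sum]
        refine Finset.sum_congr rfl fun p hp => Finset.sum_congr rfl fun l hl => ?_
        rw [hinv χ _ (hunit p hp)]
        congr 1
        obtain ⟨a, ha⟩ := hunit l hl
        have hn1 : ‖χ ((l : ℕ) : ZMod q)‖ = 1 := by rw [← ha]; exact χ.unit_norm_eq_one a
        rw [map_inv₀, ← Complex.inv_eq_conj hn1, inv_inv]
      simp only [e3]
      rw [Finset.sum_comm]
      have e4 : ∀ p ∈ P, ∑ χ : DirichletCharacter ℂ q, ∑ l ∈ P, χ ((p : ℕ) : ZMod q)⁻¹ * χ ((l : ℕ) : ZMod q) =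
          (q.totient : ℂ) := by
        intro p hp
        rw [Finset.sum_comm]
        rw [Finset.sum_congr rfl fun l _ =>
          DirichletCharacter.sum_char_inv_mul_char_eq ℂ (hunit p hp) ((l : ℕ) : ZMod q)]
        rw [Finset.sum_eq_single p]
        · simp
        · intro l hl hne
          rw [if_neg]
          intro h
          rw [ZMod.natCast_eq_natCast_iff'] at h
          rw [Nat.mod_eq_of_lt (sv_prime_odd hn hp).2, Nat.mod_eq_of_lt (sv_prime_odd hn hl).2] at h
          exact hne h.symm
        · intro h; exact absurd hp h
      rw [Finset.sum_congr rfl e4, Finset.sum_const, nsmul_eq_mul, mul_comm]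
    exact_mod_cast h1
  have hmain : S 1 ^ 2 * Xs 1 = ((P.card : ℂ)) ^ 2 * 2 ^ (n - m - 1) := by
    have h1 : S 1 = P.card := by
      simp only [hS]
      rw [Finset.sum_congr rfl fun p hp => by rw [MulChar.one_apply (hunit p hp), inv_one]]
      simp
    have h2 : Xs 1 = 2 ^ (n - m - 1) := by
      simp only [hX]
      have h3 : ∀ k ∈ Finset.range H, (1 : DirichletCharacter ℂ q) (((2 ^ (n - m) * s + k : ℤ)) : ZMod q) =
          if Odd k then 1 else 0 := by
        intro k _
        have hev : Even ((2:ℤ) ^ (n - m) * s) := Even.mul_right (Even.pow_of_ne_zero even_two (by omega)) _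
        split_ifs with ho
        · refine MulChar.one_apply ((sv_unit_iff (by omega) _).2 (hev.add_odd (by exact_mod_cast ho)))
        · refine MulChar.map_nonunit _ ?_
          rw [sv_unit_iff (by omega)]
          rw [Int.not_odd_iff_even]
          rw [Nat.not_odd_iff_even] at ho
          exact hev.add (by exact_mod_cast ho)
      rw [Finset.sum_congr rfl h3, ← Finset.sum_filter, Finset.sum_const, nsmul_eq_mul, mul_one,
        hH, sv_odd_card _ (by omega)]
      push_cast; rfl
    rw [h1, h2]
  have hdiff : (q.totient : ℂ) * (Tot : ℂ) - ((P.card : ℂ)) ^ 2 * 2 ^ (n - m - 1) =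
      ∑ χ ∈ (Finset.univ : Finset (DirichletCharacter ℂ q)).erase 1, S χ ^ 2 * Xs χ := by
    rw [htot, ← hmain, ← Finset.add_sum_erase _ _ (Finset.mem_univ 1), add_sub_cancel_left]
  have hB0 : ∀ χ ∈ (Finset.univ : Finset (DirichletCharacter ℂ q)).erase 1,
      ‖S χ ^ 2 * Xs χ‖ ≤ ‖S χ‖ ^ 2 * B := by
    intro χ hχ
    rw [norm_mul, norm_pow]
    exact mul_le_mul_of_nonneg_left (hB χ (Finset.ne_of_mem_erase hχ)) (by positivity)
  have hnormdiff : ‖(q.totient : ℂ) * (Tot : ℂ) - ((P.card : ℂ)) ^ 2 * 2 ^ (n - m - 1)‖ ≤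
      q.totient * (B * P.card) := by
    rw [hdiff]
    refine (norm_sum_le _ _).trans ((Finset.sum_le_sum hB0).trans ?_)
    rw [← Finset.sum_mul]
    have h1 : ∑ χ ∈ (Finset.univ : Finset (DirichletCharacter ℂ q)).erase 1, ‖S χ‖ ^ 2 ≤ q.totient * P.card := by
      rw [← hpar]
      exact Finset.sum_le_sum_of_subset_of_nonneg (Finset.erase_subset _ _) fun _ _ _ => by positivity
    calc _ ≤ (q.totient * P.card) * B := mul_le_mul_of_nonneg_right h1 hBn
      _ = _ := by ring
  have hreal : (q.totient : ℂ) * (Tot : ℂ) - ((P.card : ℂ)) ^ 2 * 2 ^ (n - m - 1) =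
      ((q.totient * (Tot - (P.card : ℝ) ^ 2 / 2 ^ m) : ℝ) : ℂ) := by
    have h2 : (q.totient : ℝ) = 2 ^ (n - m - 1) * 2 ^ m := by
      rw [hφ, ← pow_add]; congr 1; omega
    have h3 : (q.totient : ℝ) * (Tot - (P.card : ℝ) ^ 2 / 2 ^ m) = q.totient * Tot - (P.card : ℝ) ^ 2 * 2 ^ (n - m - 1) := by
      rw [mul_sub]
      congr 1
      rw [h2]
      field_simp
    rw [h3]; push_cast; ring
  rw [hreal, Complex.norm_real, Real.norm_eq_abs, abs_mul, abs_of_pos hφ0] at hnormdiff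
  exact le_of_mul_le_mul_left hnormdiff hφ0

theorem sum_countN_error_bound :
    ∃ C : ℝ, 0 < C ∧ ∃ n₀ : ℕ, ∀ n : ℕ, n₀ ≤ n →
      ∀ s : ℕ, s < 2 ^ ⌊(n : ℝ) - (n : ℝ) ^ ((3 : ℝ)/4) * Real.log n⌋₊ →
        |(∑ k ∈ Finset.range (2 ^ (n - ⌊(n : ℝ) - (n : ℝ) ^ ((3 : ℝ)/4) * Real.log n⌋₊)),
            (countN n ⌊(n : ℝ) - (n : ℝ) ^ ((3 : ℝ)/4) * Real.log n⌋₊ s (k : ℤ) : ℝ))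
          - ((primesP n).card : ℝ) ^ 2 / 2 ^ ⌊(n : ℝ) - (n : ℝ) ^ ((3 : ℝ)/4) * Real.log n⌋₊|
        ≤ C * 2 ^ (n - ⌊(n : ℝ) - (n : ℝ) ^ ((3 : ℝ)/4) * Real.log n⌋₊)
            * ((primesP n).card : ℝ) / (n : ℝ) ^ 2 := by
  obtain ⟨n₀, hn₀, hsize⟩ := sv_size
  refine ⟨3, by norm_num, n₀ + 1, ?_⟩
  intro n hn s _
  obtain ⟨hmn, hb⟩ := hsize n (by omega) _ rfl
  generalize ⌊(n : ℝ) - (n : ℝ) ^ ((3 : ℝ)/4) * Real.log n⌋₊ = m at *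
  have key := sv_final (n := n) (m := m) (s := s) (by omega) hmn (3 * 2 ^ (n - m) / (n : ℝ) ^ 2)
    (by positivity) ?_
  · refine key.trans (le_of_eq ?_)
    ring
  · intro χ hχ
    obtain ⟨N, hN2, hNn, hsv⟩ := sv_char_exists (by omega) χ hχ
    rcases Nat.lt_or_ge (n - m) N with hlt | hge
    · obtain ⟨b, hb1, hb2, hb3⟩ := hb (by omega)
      exact sv_bound hlt hNn hb1 hb2 hb3 hsv _
    · have := sv_zero hN2 hge hsv (2 ^ (n - m) * s)
      rw [this, norm_zero]
      positivity
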